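/- arXiv:0905.3146 — 8 statements merged into one kernel-verified Lean document; each statement's English description precedes it below -/
import Mathlib

section
/- Fix r ≥ 2. For all sufficiently large n the following holds: if s < n and n_1 + ⋯ + n_r = n are nonnegative integers with Σ_{1≤i<j≤r} n_i n_j ≥ t_r(n) − s, then ⌊n/r⌋ − s ≤ n_i ≤ ⌈n/r⌉ + s for every i. -/
open SimpleGraph Finset

/-- The number of copies of `F` in `H`: edge-preserving injections divided by `Aut(F)`. -/
noncomputable def copyCount {α β : Type*} (F : SimpleGraph α) (H : SimpleGraph β) : ℕ :=
  Nat.card {f : α ↪ β // ∀ ⦃u v⦄, F.Adj u v → H.Adj (f u) (f v)} / Nat.card (F ≃g F)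

/-- `H` contains a copy of `F`. -/
def HasCopy {α β : Type*} (F : SimpleGraph α) (H : SimpleGraph β) : Prop :=
  ∃ f : α ↪ β, ∀ ⦃u v⦄, F.Adj u v → H.Adj (f u) (f v)

/-- `F` is `r`-critical: chromatic number `r+1`, and deleting some edge makes it `r`. -/
def IsCriticalGraph (r : ℕ) {α : Type*} (F : SimpleGraph α) : Prop :=
  F.chromaticNumber = ((r + 1 : ℕ) : ℕ∞) ∧
    ∃ e ∈ F.edgeSet, (F.deleteEdges {e}).chromaticNumber = ((r : ℕ) : ℕ∞)

/-- `t_r(n)`: the number of edges of the Turán graph `T_r(n)`. -/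
noncomputable def turanEdges (r n : ℕ) : ℕ := (SimpleGraph.turanGraph n r).edgeSet.ncard

/-- `c(n,F)`: minimum number of copies of `F` in `T_r(n)` plus one edge inside a part
(the parts of `turanGraph n r` are the residue classes mod `r`). -/
noncomputable def critCount (r n : ℕ) {α : Type*} (F : SimpleGraph α) : ℕ :=
  sInf { m | ∃ u v : Fin n, u ≠ v ∧ (u : ℕ) % r = (v : ℕ) % r ∧
    m = copyCount F (SimpleGraph.turanGraph n r ⊔ SimpleGraph.fromEdgeSet {s(u, v)}) }

lemma two_mul_choose_two (n : ℕ) : (2 * n.choose 2 : ℤ) = n * (n - 1) := by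
  induction n with
  | zero => simp
  | succ k ih =>
    rw [Nat.choose_succ_succ' k 1, Nat.choose_one_right]
    push_cast
    linear_combination ih

/-- Twice the number of edges of `T_r(m + q r)` for `m < r`. -/
lemma two_mul_turanEdges {r m : ℕ} (hm : m < r) (q : ℕ) :
    (2 * turanEdges r (m + q * r) : ℤ) =
      (m + q * r) ^ 2 - (2 * q + 1) * (m + q * r) + r * q * (q + 1) := by
  have hcard (n : ℕ) : turanEdges r n = #(turanGraph n r).edgeFinset := by
    rw [turanEdges, ← coe_edgeFinset, Set.ncard_coe_finset]
  induction q with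
  | zero =>
    have h := two_mul_choose_two m
    simp only [hcard, card_edgeFinset_turanGraph, zero_mul, add_zero, Nat.mod_eq_of_lt hm,
      Nat.sub_self, Nat.zero_div, zero_add]
    push_cast
    linear_combination h
  | succ q ih =>
    have h := two_mul_choose_two r
    rw [hcard] at ih
    rw [hcard, add_mul, one_mul, ← add_assoc, card_edgeFinset_turanGraph_add]
    push_cast [Nat.cast_sub (show 1 ≤ r by omega)]
    linear_combination ih + h

lemma two_mul_sum_lt_mul_add_sum_sq {ι : Type*} [Fintype ι] [LinearOrder ι] (x : ι → ℤ) :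
    2 * (∑ i, ∑ j, if i < j then x i * x j else 0) + ∑ i, x i ^ 2 = (∑ i, x i) ^ 2 := by
  have hswap : (∑ i, ∑ j, if i < j then x i * x j else 0) =
      ∑ i, ∑ j, if j < i then x i * x j else 0 := by
    rw [sum_comm]
    simp only [mul_comm]
  have hdiag : ∑ i, x i ^ 2 = ∑ i, ∑ j, if i = j then x i * x j else 0 := by
    simp [sq]
  rw [two_mul]
  nth_rw 2 [hswap]
  rw [hdiag, sq, sum_mul_sum, ← sum_add_distrib, ← sum_add_distrib]
  refine sum_congr rfl fun i _ ↦ ?_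
  rw [← sum_add_distrib, ← sum_add_distrib]
  refine sum_congr rfl fun j _ ↦ ?_
  rcases lt_trichotomy i j with h | h | h
  · simp [h, h.not_gt, h.ne]
  · simp [h]
  · simp [h, h.not_gt, h.ne']

lemma Int.mul_sub_one_nonneg (a : ℤ) : 0 ≤ a * (a - 1) := by
  rcases le_or_gt a 0 with h | h
  · exact mul_nonneg_of_nonpos_of_nonpos h (by omega)
  · exact mul_nonneg h.le (by omega)

/-- If `s < n`, `n₁ + ⋯ + n_r = n` and `Σ_{i<j} n_i n_j ≥ t_r(n) − s`,
then `⌊n/r⌋ − s ≤ n_i ≤ ⌈n/r⌉ + s` for every `i`. -/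
theorem part_sizes_near_balanced (r : ℕ) (hr : 2 ≤ r) :
    ∃ n₀ : ℕ, ∀ n : ℕ, n₀ < n → ∀ s : ℕ, s < n → ∀ nv : Fin r → ℕ,
      (∑ i, nv i) = n →
      turanEdges r n - s ≤ ∑ i : Fin r, ∑ j : Fin r, (if i < j then nv i * nv j else 0) →
      ∀ i, n / r - s ≤ nv i ∧ nv i ≤ (n + r - 1) / r + s := by
  refine ⟨0, fun n _ s _ x hsum hle i ↦ ?_⟩
  obtain ⟨q, hq⟩ : ∃ q, q = n / r := ⟨_, rfl⟩
  obtain ⟨m, hm⟩ : ∃ m, m = n % r := ⟨_, rfl⟩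
  have hmr : m < r := hm ▸ Nat.mod_lt _ (by omega)
  have hn : m + q * r = n := by rw [hm, hq, mul_comm]; exact Nat.mod_add_div n r
  have hT := two_mul_turanEdges hmr q
  have hE := two_mul_sum_lt_mul_add_sum_sq fun j ↦ (x j : ℤ)
  have hsum' : ∑ j, (x j : ℤ) = n := by exact_mod_cast hsum
  have hn' : (m + q * r : ℤ) = n := by exact_mod_cast hn
  have hle' : (turanEdges r n : ℤ) ≤ s + ∑ j, ∑ k, if j < k then (x j : ℤ) * x k else 0 := by
    exact_mod_cast Nat.sub_le_iff_le_add'.1 hle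
  rw [hn, hn'] at hT
  rw [hsum'] at hE
  have hexpand : ∑ j, ((x j : ℤ) - q) * (x j - q - 1) =
      ∑ j, (x j : ℤ) ^ 2 - (2 * q + 1) * n + r * q * (q + 1) := by
    calc ∑ j, ((x j : ℤ) - q) * (x j - q - 1)
        = ∑ j, ((x j : ℤ) ^ 2 - (2 * q + 1) * x j + q * (q + 1)) :=
          sum_congr rfl fun j _ ↦ by ring
      _ = _ := by
          rw [sum_add_distrib, sum_sub_distrib, ← mul_sum, hsum']
          simp [mul_assoc]
  have hub : ∑ j, ((x j : ℤ) - q) * (x j - q - 1) ≤ 2 * s := by linarith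
  have hi : ((x i : ℤ) - q) * (x i - q - 1) ≤ 2 * s :=
    (single_le_sum (f := fun j ↦ ((x j : ℤ) - q) * (x j - q - 1))
      (fun j _ ↦ Int.mul_sub_one_nonneg _) (mem_univ i)).trans hub
  rw [← hq]
  constructor
  · by_contra! h
    zify at h
    have h' : (x i : ℤ) + s + 1 ≤ q := by omega
    nlinarith
  · rcases Nat.eq_zero_or_pos m with rfl | hpos
    · have hceil : (n + r - 1) / r = q := by
        rw [← hn, zero_add, show q * r + r - 1 = r - 1 + q * r by omega,
          Nat.add_mul_div_right _ _ (by omega), Nat.div_eq_of_lt (by omega), zero_add]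
      have hzero : ∑ j, ((x j : ℤ) - q) = 0 := by
        rw [sum_sub_distrib, hsum', ← hn']
        simp [mul_comm]
      have hub' : ∑ j, ((x j : ℤ) - q + 1) * (x j - q + 1 - 1) ≤ 2 * s := by
        calc ∑ j, ((x j : ℤ) - q + 1) * (x j - q + 1 - 1)
            = ∑ j, ((x j : ℤ) - q) * (x j - q - 1) + 2 * ∑ j, ((x j : ℤ) - q) := by
              rw [mul_sum, ← sum_add_distrib]
              exact sum_congr rfl fun j _ ↦ by ring
          _ ≤ 2 * s := by rw [hzero]; simpa using hub
      have hi' : ((x i : ℤ) - q + 1) * (x i - q + 1 - 1) ≤ 2 * s :=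
        (single_le_sum (f := fun j ↦ ((x j : ℤ) - q + 1) * (x j - q + 1 - 1))
          (fun j _ ↦ Int.mul_sub_one_nonneg _) (mem_univ i)).trans hub'
      rw [hceil]
      by_contra! h
      have h' : (q : ℤ) + s + 1 ≤ x i := by exact_mod_cast h
      nlinarith
    · have hceil : (n + r - 1) / r = q + 1 := by
        rw [← hn, show m + q * r + r - 1 = m - 1 + (q + 1) * r by rw [add_mul]; omega,
          Nat.add_mul_div_right _ _ (by omega), Nat.div_eq_of_lt (by omega), zero_add]
      rw [hceil]
      by_contra! h
      have h' : (q : ℤ) + 1 + s + 1 ≤ x i := by exact_mod_cast h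
      nlinarith
end

section
/- Fix r ≥ 2 and an r-critical graph F with f vertices. There exist positive constants α_F and β_F (depending only on F) such that for all sufficiently large n, |c(n,F) − α_F·n^{f−2}| < β_F·n^{f−3}. In particular, for all sufficiently large n, (α_F/2)·n^{f−2} < c(n,F) < 2α_F·n^{f−2}. -/
open SimpleGraph Finset

open scoped Classical in
/-- Triples `(x, y, χ)` where `x y` is an edge of `F` and `χ` is a proper colouring of `F` minus
that edge giving the colour `c` to both `x` and `y`. -/
noncomputable def criticalColorings {α : Type*} [Fintype α] (F : SimpleGraph α) {r : ℕ}
    (c : Fin r) : Finset (α × α × (α → Fin r)) :=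
  Finset.univ.filter fun i => F.Adj i.1 i.2.1 ∧ i.2.2 i.1 = c ∧ i.2.2 i.2.1 = c ∧
    ∀ a b, F.Adj a b → s(a, b) ≠ s(i.1, i.2.1) → i.2.2 a ≠ i.2.2 b

lemma mem_criticalColorings {α : Type*} [Fintype α] (F : SimpleGraph α) {r : ℕ} (c : Fin r)
    (i : α × α × (α → Fin r)) :
    i ∈ criticalColorings F c ↔ F.Adj i.1 i.2.1 ∧ i.2.2 i.1 = c ∧ i.2.2 i.2.1 = c ∧
      ∀ a b, F.Adj a b → s(a, b) ≠ s(i.1, i.2.1) → i.2.2 a ≠ i.2.2 b := by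
  simp [criticalColorings]

lemma card_criticalColorings_le {α : Type*} [Fintype α] (F : SimpleGraph α) {r : ℕ}
    (c d : Fin r) : (criticalColorings F c).card ≤ (criticalColorings F d).card := by
  refine Finset.card_le_card_of_injOn
    (fun i => (i.1, i.2.1, fun a => Equiv.swap c d (i.2.2 a))) ?_ ?_
  · rintro ⟨x, y, χ⟩ h
    simp only [Finset.mem_coe, mem_criticalColorings] at h ⊢
    obtain ⟨h1, h2, h3, h4⟩ := h
    refine ⟨h1, by simp [h2], by simp [h3], fun a b hab hne => ?_⟩
    simpa using h4 a b hab hne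
  · rintro ⟨x, y, χ⟩ - ⟨x', y', χ'⟩ - h
    simp only [Prod.mk.injEq] at h
    obtain ⟨rfl, rfl, h⟩ := h
    have : χ = χ' := funext fun a => (Equiv.swap c d).injective (congrFun h a)
    rw [this]

lemma card_criticalColorings_eq {α : Type*} [Fintype α] (F : SimpleGraph α) {r : ℕ}
    (c d : Fin r) : (criticalColorings F c).card = (criticalColorings F d).card :=
  le_antisymm (card_criticalColorings_le F c d) (card_criticalColorings_le F d c)

lemma IsCriticalGraph.not_colorable {α : Type*} {r : ℕ} {F : SimpleGraph α}
    (hF : IsCriticalGraph r F) : ¬ F.Colorable r := by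
  intro h
  have := h.chromaticNumber_le
  rw [hF.1] at this
  have : r + 1 ≤ r := by exact_mod_cast this
  omega

lemma IsCriticalGraph.lt_card {α : Type*} [Fintype α] {r : ℕ} {F : SimpleGraph α}
    (hF : IsCriticalGraph r F) : r < Fintype.card α := by
  by_contra! h
  exact hF.not_colorable (F.colorable_of_fintype.mono h)

lemma IsCriticalGraph.exists_criticalColorings_pos {α : Type*} [Fintype α] {r : ℕ}
    {F : SimpleGraph α} (hF : IsCriticalGraph r F) :
    ∃ c : Fin r, 0 < (criticalColorings F c).card := by
  obtain ⟨e, he, hr⟩ := hF.2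
  have hcol : (F.deleteEdges {e}).Colorable r :=
    SimpleGraph.chromaticNumber_le_iff_colorable.1 hr.le
  obtain ⟨C⟩ := hcol
  induction e using Sym2.ind with
  | _ x y =>
  have hadj : F.Adj x y := he
  have hC : ∀ a b, F.Adj a b → s(a, b) ≠ s(x, y) → C a ≠ C b := fun a b hab hne =>
    C.valid (by simpa [SimpleGraph.deleteEdges_adj, hab] using hne)
  have hxy : C y = C x := by
    by_contra hne
    refine hF.not_colorable ⟨SimpleGraph.Coloring.mk C fun {a b} hab => ?_⟩
    by_cases h : s(a, b) = s(x, y)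
    · rcases Sym2.eq_iff.1 h with ⟨rfl, rfl⟩ | ⟨rfl, rfl⟩
      · exact fun h => hne h.symm
      · exact hne
    · exact hC a b hab h
  refine ⟨C x, Finset.card_pos.2 ⟨(x, y, C), ?_⟩⟩
  rw [mem_criticalColorings]
  exact ⟨hadj, rfl, hxy, hC⟩

/-- Admissible images of the vertices for maps of residue pattern `i.2.2` sending `i.1` to `u`
and `i.2.1` to `v`. -/
def admissibleImages {α : Type*} [DecidableEq α] {r n : ℕ} (u v : Fin n)
    (i : α × α × (α → Fin r)) (z : α) : Finset (Fin n) :=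
  if z = i.1 then {u} else if z = i.2.1 then {v} else
    Finset.univ.filter fun k => (k : ℕ) % r = i.2.2 z

/-- Injective maps to `Fin n` subject to the constraints `admissibleImages`. -/
def admissibleInjections {α : Type*} [Fintype α] [DecidableEq α] {r n : ℕ}
    (u v : Fin n) (i : α × α × (α → Fin r)) : Finset (α → Fin n) :=
  (Fintype.piFinset (admissibleImages u v i)).filter Function.Injective

lemma mem_admissibleInjections {α : Type*} [Fintype α] [DecidableEq α]
    {F : SimpleGraph α} {r n : ℕ} {u v : Fin n} (huv : (u : ℕ) % r = (v : ℕ) % r)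
    {c : Fin r} (hc : (u : ℕ) % r = c) {i : α × α × (α → Fin r)}
    (hi : i ∈ criticalColorings F c) (g : α → Fin n) :
    g ∈ admissibleInjections u v i ↔ Function.Injective g ∧ g i.1 = u ∧ g i.2.1 = v ∧
      ∀ z, (g z : ℕ) % r = i.2.2 z := by
  obtain ⟨x, y, χ⟩ := i
  rw [mem_criticalColorings] at hi
  obtain ⟨hadj, hx, hy, -⟩ := hi
  have hne : y ≠ x := hadj.ne'
  dsimp only at hx hy ⊢
  simp only [admissibleInjections, Finset.mem_filter, Fintype.mem_piFinset, admissibleImages]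
  constructor
  · rintro ⟨h, hg⟩
    have h1 : g x = u := by simpa using h x
    have h2 : g y = v := by simpa [hne] using h y
    refine ⟨hg, h1, h2, fun z => ?_⟩
    by_cases hzx : z = x
    · rw [hzx, h1, hx, hc]
    by_cases hzy : z = y
    · rw [hzy, h2, hy, ← hc, huv]
    simpa [hzx, hzy] using h z
  · rintro ⟨hg, h1, h2, h3⟩
    refine ⟨fun z => ?_, hg⟩
    split_ifs with hzx hzy
    · simp [hzx, h1]
    · simp [hzy, h2]
    · simp [h3]

lemma natCard_embeddings_eq_sum {α : Type*} [Fintype α] [DecidableEq α]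
    {F : SimpleGraph α} {r n : ℕ} (hF : ¬ F.Colorable r) {u v : Fin n}
    (huv : (u : ℕ) % r = (v : ℕ) % r) {c : Fin r} (hc : (u : ℕ) % r = c) :
    Nat.card {f : α ↪ Fin n // ∀ ⦃a b⦄, F.Adj a b →
      (SimpleGraph.turanGraph n r ⊔ SimpleGraph.fromEdgeSet {s(u, v)}).Adj (f a) (f b)} =
    ∑ i ∈ criticalColorings F c, (admissibleInjections u v i).card := by
  have hr : 0 < r := c.pos
  rw [← Finset.card_biUnion]
  · rw [← Fintype.card_coe, ← Nat.card_eq_fintype_card]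
    refine Nat.card_congr (Equiv.ofBijective (fun f => ⟨f.1, ?_⟩) ⟨?_, ?_⟩)
    · obtain ⟨f, hf⟩ := f
      simp only [SimpleGraph.sup_adj, SimpleGraph.turanGraph, SimpleGraph.fromEdgeSet_adj,
        Set.mem_singleton_iff] at hf
      have hex : ∃ x y, F.Adj x y ∧ f x = u ∧ f y = v := by
        by_contra! hcon
        refine hF ⟨SimpleGraph.Coloring.mk
          (fun a => (⟨f a % r, Nat.mod_lt _ hr⟩ : Fin r)) fun {a b} hab h => ?_⟩
        rcases hf hab with h' | ⟨h', -⟩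
        · exact h' (by simpa using h)
        · rcases Sym2.eq_iff.1 h' with ⟨h1, h2⟩ | ⟨h1, h2⟩
          · exact hcon a b hab h1 h2
          · exact hcon b a hab.symm h2 h1
      obtain ⟨x, y, hxy, hx, hy⟩ := hex
      have hi : (x, y, fun a => (⟨f a % r, Nat.mod_lt _ hr⟩ : Fin r)) ∈
          criticalColorings F c := by
        rw [mem_criticalColorings]
        refine ⟨hxy, Fin.ext (by simp [hx, hc]), Fin.ext (by simp [hy, ← huv, hc]), ?_⟩
        intro a b hab hs h
        rcases hf hab with h' | ⟨h', -⟩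
        · exact h' (by simpa using h)
        · apply hs
          rw [← hx, ← hy] at h'
          rcases Sym2.eq_iff.1 h' with ⟨h1, h2⟩ | ⟨h1, h2⟩
          · rw [f.injective h1, f.injective h2]
          · rw [f.injective h1, f.injective h2, Sym2.eq_swap]
      rw [Finset.mem_biUnion]
      exact ⟨_, hi, (mem_admissibleInjections huv hc hi _).2 ⟨f.injective, hx, hy, fun _ => rfl⟩⟩
    · rintro ⟨f, hf⟩ ⟨g, hg⟩ h
      simpa using h
    · rintro ⟨g, hg⟩
      obtain ⟨i, hi, hgi⟩ := Finset.mem_biUnion.1 hg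
      rw [mem_admissibleInjections huv hc hi] at hgi
      obtain ⟨hinj, hx, hy, hχ⟩ := hgi
      rw [mem_criticalColorings] at hi
      refine ⟨⟨⟨g, hinj⟩, fun a b hab => ?_⟩, rfl⟩
      simp only [SimpleGraph.sup_adj, SimpleGraph.turanGraph, SimpleGraph.fromEdgeSet_adj,
        Set.mem_singleton_iff, Function.Embedding.coeFn_mk]
      by_cases hs : s(a, b) = s(i.1, i.2.1)
      · right
        refine ⟨?_, hinj.ne hab.ne⟩
        have := congrArg (Sym2.map g) hs
        simpa [hx, hy] using this
      · left
        rw [hχ, hχ]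
        exact fun h => hi.2.2.2 a b hab hs (Fin.ext h)
  · intro i hi j hj hij
    rw [Function.onFun, Finset.disjoint_left]
    intro g hgi hgj
    rw [mem_admissibleInjections huv hc hi] at hgi
    rw [mem_admissibleInjections huv hc hj] at hgj
    apply hij
    refine Prod.ext (hgi.1 (hgi.2.1.trans hgj.2.1.symm))
      (Prod.ext (hgi.1 (hgi.2.2.1.trans hgj.2.2.1.symm)) (funext fun z => Fin.ext ?_))
    rw [← hgi.2.2.2 z, hgj.2.2.2 z]

lemma abs_card_residue_sub_le {r n : ℕ} (c : Fin r) :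
    |(((Finset.univ.filter fun k : Fin n => (k : ℕ) % r = c).card : ℕ) : ℝ) - n / r| ≤ 1 := by
  have hr : 0 < r := c.pos
  have hcard : (Finset.univ.filter fun k : Fin n => (k : ℕ) % r = c).card =
      Nat.count (· ≡ (c : ℕ) [MOD r]) n := by
    rw [Nat.count_eq_card_filter_range]
    refine Finset.card_bij (fun k _ => (k : ℕ)) ?_ (fun a _ b _ h => Fin.ext h) ?_
    · intro k hk
      simpa [Nat.ModEq, Nat.mod_eq_of_lt c.isLt] using hk
    · intro k hk
      simp only [Finset.mem_filter, Finset.mem_range] at hk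
      exact ⟨⟨k, hk.1⟩, by simpa [Nat.ModEq, Nat.mod_eq_of_lt c.isLt] using hk.2, rfl⟩
  rw [hcard, Nat.count_modEq_card n hr c]
  have hr' : (0 : ℝ) < r := by exact_mod_cast hr
  have h1 : ((n / r : ℕ) : ℝ) ≤ n / r := Nat.cast_div_le
  have h2 : (n : ℝ) / r < (n / r : ℕ) + 1 := by
    rw [div_lt_iff₀ hr']
    exact_mod_cast Nat.lt_mul_of_div_lt (Nat.lt_succ_self _) hr
  rw [abs_le]
  split_ifs <;> constructor <;> push_cast <;> linarith

lemma card_admissibleImages_le {α : Type*} [DecidableEq α] {r n : ℕ} (u v : Fin n)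
    (i : α × α × (α → Fin r)) (z : α) : (admissibleImages u v i z).card ≤ n := by
  simpa using Finset.card_le_univ (admissibleImages u v i z)

lemma abs_card_piFinset_admissibleImages_sub_le {α : Type*} [Fintype α] [DecidableEq α] {r n : ℕ}
    (hrn : r ≤ n) (u v : Fin n) (i : α × α × (α → Fin r)) (hi : i.1 ≠ i.2.1) :
    |((Fintype.piFinset (admissibleImages u v i)).card : ℝ) -
        ((n : ℝ) / r) ^ (Fintype.card α - 2)| ≤
      (Fintype.card α - 2 : ℕ) * (2 * n : ℝ) ^ (Fintype.card α - 3) := by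
  obtain ⟨x, y, χ⟩ := i
  have hne : x ≠ y := hi
  have hr : 0 < r := (χ x).pos
  have hr' : (1 : ℝ) ≤ r := by exact_mod_cast hr
  have hrn' : (r : ℝ) ≤ n := by exact_mod_cast hrn
  set t : ℝ := (n : ℝ) / r with ht
  have ht1 : 1 ≤ t := by rw [ht, one_le_div (by linarith)]; exact hrn'
  have htn : t ≤ n := div_le_self (by linarith) hr'
  set s : Finset α := (Finset.univ.erase x).erase y with hs
  have hscard : s.card = Fintype.card α - 2 := by
    rw [hs, Finset.card_erase_of_mem (by simp [hne.symm]), Finset.card_erase_of_mem (by simp),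
      Finset.card_univ]
    omega
  have hprod : ((Fintype.piFinset (admissibleImages u v (x, y, χ))).card : ℝ) =
      ∏ z ∈ s, ((Finset.univ.filter fun k : Fin n => (k : ℕ) % r = χ z).card : ℝ) := by
    rw [Fintype.card_piFinset, hs]
    push_cast
    rw [← Finset.prod_erase Finset.univ (a := x) (by simp [admissibleImages]),
      ← Finset.prod_erase (Finset.univ.erase x) (a := y)
        (by simp [admissibleImages, hne.symm])]
    refine Finset.prod_congr rfl fun z hz => ?_
    simp only [Finset.mem_erase, Finset.mem_univ, and_true] at hz
    simp [admissibleImages, hz.1, hz.2]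
  have hbd (z : α) := abs_le.1 (abs_card_residue_sub_le (n := n) (χ z))
  have hup : ∏ z ∈ s, ((Finset.univ.filter fun k : Fin n => (k : ℕ) % r = χ z).card : ℝ) ≤
      (t + 1) ^ (Fintype.card α - 2) := by
    rw [← hscard, ← Finset.prod_const]
    exact Finset.prod_le_prod (fun _ _ => by positivity) fun z _ => by linarith [(hbd z).2]
  have hlow : (t - 1) ^ (Fintype.card α - 2) ≤
      ∏ z ∈ s, ((Finset.univ.filter fun k : Fin n => (k : ℕ) % r = χ z).card : ℝ) := by
    rw [← hscard, ← Finset.prod_const]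
    exact Finset.prod_le_prod (fun _ _ => by linarith) fun z _ => by linarith [(hbd z).1]
  have key (a : ℝ) (ha : |a - t| = 1) (ha0 : 0 ≤ a) (han : a ≤ 2 * n) :
      |a ^ (Fintype.card α - 2) - t ^ (Fintype.card α - 2)| ≤
        (Fintype.card α - 2 : ℕ) * (2 * n : ℝ) ^ (Fintype.card α - 3) := by
    refine (abs_pow_sub_pow_le a t _).trans ?_
    rw [ha, one_mul, Nat.sub_sub]
    gcongr
    rw [abs_of_nonneg ha0, abs_of_nonneg (by linarith)]
    exact max_le han (by linarith)
  have k1 := abs_le.1 (key (t + 1) (by simp) (by linarith) (by linarith))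
  have k2 := abs_le.1 (key (t - 1) (by simp) (by linarith) (by linarith))
  rw [hprod, abs_le]
  constructor <;> linarith [k1.2, k2.1]

lemma card_filter_apply_eq_apply_le {α : Type*} [Fintype α] [DecidableEq α] {r n : ℕ}
    {u v : Fin n} {i : α × α × (α → Fin r)} (hi : i.1 ≠ i.2.1) {a b : α} (hab : a ≠ b)
    (hb₁ : b ≠ i.1) (hb₂ : b ≠ i.2.1) :
    ((Fintype.piFinset (admissibleImages u v i)).filter fun g => g a = g b).card ≤
      n ^ (Fintype.card α - 3) := by
  obtain ⟨x, y, χ⟩ := i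
  dsimp only at hi hb₁ hb₂
  let T : α → Finset (Fin n) := fun z =>
    if z = b then {u} else admissibleImages u v (x, y, χ) z
  calc _ ≤ (Fintype.piFinset T).card := by
        refine Finset.card_le_card_of_injOn (fun g => Function.update g b u) ?_ ?_
        · intro g hg
          simp only [Finset.coe_filter, Fintype.mem_piFinset, Set.mem_ofPred_eq] at hg
          simp only [Finset.mem_coe, Fintype.mem_piFinset, T]
          intro z
          by_cases hz : z = b
          · simp [hz]
          · simpa [hz] using hg.1 z
        · intro g hg g' hg' h
          simp only [Finset.coe_filter, Set.mem_ofPred_eq] at hg hg'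
          have hz (z : α) (hz : z ≠ b) : g z = g' z := by
            simpa [hz] using congrFun h z
          funext z
          by_cases h' : z = b
          · rw [h', ← hg.2, ← hg'.2, hz a hab]
          · exact hz z h'
    _ = ∏ z ∈ ((Finset.univ.erase x).erase y).erase b, (T z).card := by
        rw [Fintype.card_piFinset,
          Finset.prod_erase _ (by simp [T]),
          Finset.prod_erase _ (by simp [T, admissibleImages, hi.symm, hb₂.symm]),
          Finset.prod_erase _ (by simp [T, admissibleImages, hb₁.symm])]
    _ ≤ n ^ (((Finset.univ.erase x).erase y).erase b).card :=
        Finset.prod_le_pow_card _ _ _ fun z hz => by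
          simpa [T, (Finset.mem_erase.1 hz).1] using card_admissibleImages_le u v (x, y, χ) z
    _ = n ^ (Fintype.card α - 3) := by
        rw [Finset.card_erase_of_mem (by simp [hb₁, hb₂]),
          Finset.card_erase_of_mem (by simp [hi.symm]), Finset.card_erase_of_mem (by simp),
          Finset.card_univ]
        congr 1

lemma card_piFinset_le_card_admissibleInjections_add {α : Type*} [Fintype α]
    [DecidableEq α] {r n : ℕ}
    {u v : Fin n} (huv : u ≠ v) {i : α × α × (α → Fin r)} (hi : i.1 ≠ i.2.1) :
    (Fintype.piFinset (admissibleImages u v i)).card ≤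
      (admissibleInjections u v i).card +
        Fintype.card α ^ 2 * n ^ (Fintype.card α - 3) := by
  set P := Fintype.piFinset (admissibleImages u v i) with hP
  set Q : Finset (α × α) := Finset.univ.filter fun p => p.1 ≠ p.2 ∧ p.2 ≠ i.1 ∧ p.2 ≠ i.2.1
    with hQ
  have hsub : P ⊆ admissibleInjections u v i ∪
      Q.biUnion fun p => P.filter fun g => g p.1 = g p.2 := by
    intro g hg
    by_cases hinj : Function.Injective g
    · exact Finset.mem_union_left _ (by
        rw [admissibleInjections, Finset.mem_filter]; exact ⟨hg, hinj⟩)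
    refine Finset.mem_union_right _ (Finset.mem_biUnion.2 ?_)
    rw [Function.Injective] at hinj
    push Not at hinj
    obtain ⟨a, b, hab, hne⟩ := hinj
    have hg' := Fintype.mem_piFinset.1 hg
    have hx : g i.1 = u := by simpa [admissibleImages] using hg' i.1
    have hy : g i.2.1 = v := by simpa [admissibleImages, hi.symm] using hg' i.2.1
    by_cases hb : b ≠ i.1 ∧ b ≠ i.2.1
    · exact ⟨(a, b), by simp [hQ, hne, hb], by simp [hg, hab]⟩
    by_cases ha : a ≠ i.1 ∧ a ≠ i.2.1
    · exact ⟨(b, a), by simp [hQ, hne.symm, ha], by simp [hg, hab]⟩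
    exfalso
    grind
  calc P.card ≤ _ := Finset.card_le_card hsub
    _ ≤ _ := Finset.card_union_le _ _
    _ ≤ _ := by
      gcongr
      calc _ ≤ ∑ p ∈ Q, (P.filter fun g => g p.1 = g p.2).card := Finset.card_biUnion_le
        _ ≤ ∑ _p ∈ Q, n ^ (Fintype.card α - 3) := Finset.sum_le_sum fun p hp => by
            simp only [hQ, Finset.mem_filter, Finset.mem_univ, true_and] at hp
            exact card_filter_apply_eq_apply_le hi hp.1 hp.2.1 hp.2.2
        _ ≤ _ := by
            rw [Finset.sum_const, smul_eq_mul]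
            gcongr
            calc Q.card ≤ Fintype.card (α × α) := Finset.card_le_univ _
              _ = _ := by rw [Fintype.card_prod, sq]

lemma abs_card_admissibleInjections_sub_le {α : Type*} [Fintype α] [DecidableEq α]
    {r n : ℕ} (hrn : r ≤ n) {u v : Fin n} (huv : u ≠ v) {i : α × α × (α → Fin r)}
    (hi : i.1 ≠ i.2.1) :
    |((admissibleInjections u v i).card : ℝ) - ((n : ℝ) / r) ^ (Fintype.card α - 2)| ≤
      ((Fintype.card α - 2 : ℕ) * 2 ^ (Fintype.card α - 3) + (Fintype.card α : ℝ) ^ 2) *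
        (n : ℝ) ^ (Fintype.card α - 3) := by
  have h1 := abs_card_piFinset_admissibleImages_sub_le hrn u v i hi
  have h2 : ((Fintype.piFinset (admissibleImages u v i)).card : ℝ) ≤
      ((admissibleInjections u v i).card +
        Fintype.card α ^ 2 * n ^ (Fintype.card α - 3) : ℕ) := by
    exact_mod_cast card_piFinset_le_card_admissibleInjections_add huv hi
  have h3 : ((admissibleInjections u v i).card : ℝ) ≤
      (Fintype.piFinset (admissibleImages u v i)).card := by
    rw [admissibleInjections]
    exact_mod_cast Finset.card_filter_le _ _
  push_cast at h2
  have h4 : (0 : ℝ) ≤ (Fintype.card α : ℝ) ^ 2 * (n : ℝ) ^ (Fintype.card α - 3) := by positivity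
  rw [mul_pow, abs_le] at h1
  rw [abs_le, add_mul, mul_assoc]
  constructor <;> linarith [h1.1, h1.2]

lemma exists_copyCount_asymptotics {α : Type*} [Fintype α] {r : ℕ} (hr : 0 < r)
    {F : SimpleGraph α} (hF : IsCriticalGraph r F) :
    ∃ A B : ℝ, 0 < A ∧ 0 < B ∧ ∀ n : ℕ, r ≤ n → ∀ u v : Fin n, u ≠ v →
      (u : ℕ) % r = (v : ℕ) % r →
      |(_root_.copyCount F (SimpleGraph.turanGraph n r ⊔ SimpleGraph.fromEdgeSet {s(u, v)}) : ℝ) -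
        A * (n : ℝ) ^ (Fintype.card α - 2)| < B * (n : ℝ) ^ (Fintype.card α - 3) := by
  classical
  obtain ⟨c₀, hM⟩ := hF.exists_criticalColorings_pos
  set M := (criticalColorings F c₀).card with hMdef
  set m := Fintype.card α - 2
  set C : ℝ := (m : ℕ) * 2 ^ (Fintype.card α - 3) + (Fintype.card α : ℝ) ^ 2 with hC
  have hfin : Finite (F ≃g F) := Finite.of_injective _ DFunLike.coe_injective
  set a := Nat.card (F ≃g F) with ha
  have ha1 : 0 < a := Nat.card_pos
  have ha' : (0 : ℝ) < a := by exact_mod_cast ha1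
  have hr' : (0 : ℝ) < r := by exact_mod_cast hr
  have hM' : (0 : ℝ) < M := by exact_mod_cast hM
  have hC0 : 0 ≤ C := by positivity
  refine ⟨M / (r ^ m * a), M * C / a + 2, by positivity, by positivity, ?_⟩
  intro n hrn u v hne huv
  have hsum := natCard_embeddings_eq_sum hF.not_colorable huv
    (c := ⟨u % r, Nat.mod_lt _ hr⟩) rfl
  set N := Nat.card {f : α ↪ Fin n // ∀ ⦃a b⦄, F.Adj a b →
      (SimpleGraph.turanGraph n r ⊔ SimpleGraph.fromEdgeSet {s(u, v)}).Adj (f a) (f b)} with hN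
  have hcc : _root_.copyCount F (SimpleGraph.turanGraph n r ⊔ SimpleGraph.fromEdgeSet {s(u, v)}) =
      N / a := rfl
  rw [hcc]
  have hNM : |(N : ℝ) - M * ((n : ℝ) / r) ^ m| ≤ M * (C * (n : ℝ) ^ (Fintype.card α - 3)) := by
    rw [hsum, hMdef, card_criticalColorings_eq F c₀ ⟨u % r, Nat.mod_lt _ hr⟩]
    push_cast
    rw [← nsmul_eq_mul, ← nsmul_eq_mul, ← Finset.sum_const, ← Finset.sum_const,
      ← Finset.sum_sub_distrib]
    refine (Finset.abs_sum_le_sum_abs _ _).trans (Finset.sum_le_sum fun i hi => ?_)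
    exact abs_card_admissibleInjections_sub_le hrn hne
      ((mem_criticalColorings F _ i).1 hi).1.ne
  have hn1 : (1 : ℝ) ≤ (n : ℝ) ^ (Fintype.card α - 3) :=
    one_le_pow₀ (by exact_mod_cast hr.trans_le hrn)
  have h1 : ((N / a : ℕ) : ℝ) ≤ N / a := Nat.cast_div_le
  have h2 : (N : ℝ) / a < (N / a : ℕ) + 1 := by
    rw [div_lt_iff₀ ha']
    exact_mod_cast Nat.lt_mul_of_div_lt (Nat.lt_succ_self _) ha1
  have h3 : |(N : ℝ) / a - M / (r ^ m * a) * (n : ℝ) ^ m| ≤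
      M * C / a * (n : ℝ) ^ (Fintype.card α - 3) := by
    have e1 : (N : ℝ) / a - M / (r ^ m * a) * (n : ℝ) ^ m =
        (N - M * ((n : ℝ) / r) ^ m) / a := by
      rw [div_pow]; field_simp
    have e2 : M * C / a * (n : ℝ) ^ (Fintype.card α - 3) =
        M * (C * (n : ℝ) ^ (Fintype.card α - 3)) / a := by ring
    rw [e1, e2, abs_div, abs_of_pos ha']
    gcongr
  rw [abs_le] at h3
  rw [abs_lt, add_mul]
  constructor <;> linarith [h3.1, h3.2]

/-- For `r ≥ 2` and an `r`-critical graph `F` on `f` vertices, there are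
positive constants `α_F, β_F` with `|c(n,F) − α_F n^{f−2}| < β_F n^{f−3}` for all large `n`;
in particular `(α_F/2) n^{f−2} < c(n,F) < 2 α_F n^{f−2}`. -/
theorem critCount_asymptotics {α : Type} [Fintype α] (r : ℕ) (hr : 2 ≤ r)
    (F : SimpleGraph α) (hF : IsCriticalGraph r F) :
    ∃ αF βF : ℝ, 0 < αF ∧ 0 < βF ∧ ∃ n₀ : ℕ, ∀ n : ℕ, n₀ < n →
      |(critCount r n F : ℝ) - αF * (n : ℝ) ^ (Fintype.card α - 2)| <
          βF * (n : ℝ) ^ (Fintype.card α - 3) ∧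
      (αF / 2) * (n : ℝ) ^ (Fintype.card α - 2) < (critCount r n F : ℝ) ∧
      (critCount r n F : ℝ) < 2 * αF * (n : ℝ) ^ (Fintype.card α - 2) := by
  obtain ⟨A, B, hA, hB, h⟩ := exists_copyCount_asymptotics (by omega : 0 < r) hF
  have hcard := hF.lt_card
  refine ⟨A, B, hA, hB, max r ⌈2 * B / A⌉₊, fun n hn => ?_⟩
  obtain ⟨hrn, hBn⟩ := max_lt_iff.1 hn
  have hmem : critCount r n F ∈ { m | ∃ u v : Fin n, u ≠ v ∧ (u : ℕ) % r = (v : ℕ) % r ∧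
      m = _root_.copyCount F (SimpleGraph.turanGraph n r ⊔ SimpleGraph.fromEdgeSet {s(u, v)}) } :=
    Nat.sInf_mem ⟨_, ⟨0, by omega⟩, ⟨r, hrn⟩, by simp [Fin.ext_iff]; omega, by simp, rfl⟩
  obtain ⟨u, v, hne, huv, heq⟩ := hmem
  have key := h n hrn.le u v hne huv
  rw [← heq] at key
  have hn0 : (0 : ℝ) < n := by exact_mod_cast (by omega : 0 < n)
  have hBn' : 2 * B < n * A := by
    rw [← div_lt_iff₀ hA]
    exact Nat.lt_of_ceil_lt hBn
  have hpow : (n : ℝ) ^ (Fintype.card α - 2) = n * (n : ℝ) ^ (Fintype.card α - 3) := by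
    rw [← pow_succ']
    congr 1
    omega
  have hp : (0 : ℝ) < (n : ℝ) ^ (Fintype.card α - 3) := by positivity
  have hlt : B * (n : ℝ) ^ (Fintype.card α - 3) <
      A / 2 * (n : ℝ) ^ (Fintype.card α - 2) := by
    rw [hpow, ← mul_assoc]
    exact mul_lt_mul_of_pos_right (by linarith) hp
  have hAp : 0 < A * (n : ℝ) ^ (Fintype.card α - 2) := by positivity
  refine ⟨key, ?_, ?_⟩
  · linarith [(abs_lt.1 key).1]
  · linarith [(abs_lt.1 key).2]
end

section
/- Fix r ≥ 2 and an r-critical graph F with f vertices. There is a positive constant γ_F depending only on F such that for all sufficiently large n the following holds: if n_1 + ⋯ + n_r = n with ⌊n/r⌋ − s ≤ n_i ≤ ⌈n/r⌉ + s for every i, and s < n/(3r), then c(n_1, …, n_r, F) ≥ c(n,F) − γ_F·s·n^{f−3}. -/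
open SimpleGraph Finset

/-- The complete multipartite graph with parts `Fin (nv i)` together with one extra edge
inside the part indexed by `0` (joining the vertices numbered `0` and `1` of that part). -/
noncomputable def multipartitePlusEdge (r : ℕ) (nv : Fin r → ℕ) :
    SimpleGraph (Σ i : Fin r, Fin (nv i)) :=
  completeMultipartiteGraph (fun i => Fin (nv i)) ⊔
    SimpleGraph.fromEdgeSet {e | ∃ u v : Σ i : Fin r, Fin (nv i),
      (u.1 : ℕ) = 0 ∧ (v.1 : ℕ) = 0 ∧ (u.2 : ℕ) = 0 ∧ (v.2 : ℕ) = 1 ∧ e = s(u, v)}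

/-- `c(n₁, …, n_r, F)`: the number of copies of `F` in the complete `r`-partite graph with
parts of sizes `n₁, …, n_r` plus one edge inside the part of size `n₁`. -/
noncomputable def critCountMulti (r : ℕ) (nv : Fin r → ℕ) {α : Type*} (F : SimpleGraph α) : ℕ :=
  copyCount F (multipartitePlusEdge r nv)

/-- Embeddings with prescribed values on `s` are determined by their values off `s`. -/
theorem card_filter_embedding_le {α β : Type*} [Fintype α] [DecidableEq α] [Fintype β]
    [DecidableEq β] (s : Finset α) (g : α → β) :
    #{f : α ↪ β | ∀ a ∈ s, f a = g a} ≤ Fintype.card β ^ (Fintype.card α - #s) := by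
  have h : Fintype.card ({a // a ∈ sᶜ} → β) = Fintype.card β ^ (Fintype.card α - #s) := by
    rw [Fintype.card_fun, Fintype.card_coe, card_compl]
  rw [← h, ← card_univ]
  refine card_le_card_of_injOn (fun f a => f a) (fun _ _ => mem_coe.2 (mem_univ _)) ?_
  intro f hf f' hf' heq
  simp only [coe_filter, mem_univ, true_and, Set.mem_ofPred_eq] at hf hf'
  ext a
  by_cases ha : a ∈ s
  · rw [hf a ha, hf' a ha]
  · exact congrFun heq ⟨a, mem_compl.2 ha⟩

/-- A copy of a non-`r`-colorable graph in an `r`-colorable graph plus an edge uses this edge. -/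
theorem exists_map_eq_of_not_colorable {α β : Type*} {r : ℕ} {F : SimpleGraph α}
    {G : SimpleGraph β} (hF : ¬ F.Colorable r) (hG : G.Colorable r) {u v : β} {f : α → β}
    (hf : ∀ ⦃a b⦄, F.Adj a b → (G ⊔ fromEdgeSet {s(u, v)}).Adj (f a) (f b)) :
    ∃ a b, F.Adj a b ∧ f a = u ∧ f b = v := by
  by_contra! hno
  refine hF (hG.of_hom (f := ⟨f, fun {a b} hab => ?_⟩))
  have h := hf hab
  rw [sup_adj, fromEdgeSet_adj, Set.mem_singleton_iff, Sym2.eq_iff] at h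
  rcases h with h | ⟨⟨h1, h2⟩ | ⟨h1, h2⟩, -⟩
  · exact h
  · exact absurd h2 (hno a b hab h1)
  · exact absurd h1 (hno b a hab.symm h2)

/-- If an `r`-colorable graph plus an edge `uv` maps injectively to `H` outside a set `bad` avoiding
`u` and `v`, then `H` has almost as many labelled copies of a non-`r`-colorable `F`. -/
theorem card_copies_le_add {α β γ : Type*} [Fintype α] [Fintype β] [Finite γ] {r : ℕ}
    {F : SimpleGraph α} {G : SimpleGraph β} {H : SimpleGraph γ} (hF : ¬ F.Colorable r)
    (hG : G.Colorable r) {u v : β} (bad : Finset β) (hu : u ∉ bad) (hv : v ∉ bad)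
    (φ : β → γ) (hφ : Set.InjOn φ {x | x ∉ bad})
    (hadj : ∀ x ∉ bad, ∀ y ∉ bad, (G ⊔ fromEdgeSet {s(u, v)}).Adj x y → H.Adj (φ x) (φ y)) :
    Nat.card {f : α ↪ β // ∀ ⦃a b⦄, F.Adj a b →
        (G ⊔ fromEdgeSet {s(u, v)}).Adj (f a) (f b)} ≤
      Nat.card {f : α ↪ γ // ∀ ⦃a b⦄, F.Adj a b → H.Adj (f a) (f b)} +
        Fintype.card α ^ 3 * #bad * Fintype.card β ^ (Fintype.card α - 3) := by
  classical
  set E : Finset (α ↪ β) := {f : α ↪ β | ∀ ⦃a b⦄, F.Adj a b →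
    (G ⊔ fromEdgeSet {s(u, v)}).Adj (f a) (f b)}
  rw [show Nat.card {f : α ↪ β // ∀ ⦃a b⦄, F.Adj a b →
    (G ⊔ fromEdgeSet {s(u, v)}).Adj (f a) (f b)} = #E by
      rw [Nat.card_eq_fintype_card, Fintype.card_subtype],
    ← card_filter_add_card_filter_not (s := E) (fun f => ∀ a, f a ∉ bad)]
  refine add_le_add ?_ ?_
  · rw [← Fintype.card_coe, ← Nat.card_eq_fintype_card]
    refine Nat.card_le_card_of_injective (fun f => ⟨⟨fun a => φ (f.1 a), fun a b hab => ?_⟩,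
      fun a b hab => ?_⟩) fun f f' hff => ?_
    · have hf := (mem_filter.1 f.2).2
      exact f.1.injective (hφ (hf a) (hf b) hab)
    · have hf := mem_filter.1 f.2
      exact hadj _ (hf.2 a) _ (hf.2 b) ((mem_filter.1 hf.1).2 hab)
    · have hf := (mem_filter.1 f.2).2
      have hf' := (mem_filter.1 f'.2).2
      ext a
      have h := DFunLike.congr_fun (congrArg Subtype.val hff) a
      exact hφ (hf a) (hf' a) h
  · set g : α × α → β → α → β := fun t x d => if d = t.1 then u else if d = t.2 then v else x
      with hg
    set I : Finset ((α × α × α) × β) :=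
      ({t : α × α × α | #{t.1, t.2.1, t.2.2} = 3} : Finset _) ×ˢ bad with hI
    have hsub : E.filter (fun f => ¬ ∀ a, f a ∉ bad) ⊆ I.biUnion fun p =>
        {f : α ↪ β | ∀ d ∈ ({p.1.1, p.1.2.1, p.1.2.2} : Finset α),
          f d = g (p.1.1, p.1.2.1) p.2 d} := by
      intro f hf
      obtain ⟨hfE, hfb⟩ := mem_filter.1 hf
      push Not at hfb
      obtain ⟨c, hc⟩ := hfb
      obtain ⟨a, b, hab, rfl, rfl⟩ := exists_map_eq_of_not_colorable hF hG (mem_filter.1 hfE).2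
      have hca : c ≠ a := fun h => hu (h ▸ hc)
      have hcb : c ≠ b := fun h => hv (h ▸ hc)
      refine mem_biUnion.2 ⟨((a, b, c), f c), ?_, ?_⟩
      · exact mem_product.2 ⟨mem_filter.2 ⟨mem_univ _,
          card_eq_three.2 ⟨a, b, c, hab.ne, hca.symm, hcb.symm, rfl⟩⟩, hc⟩
      · refine mem_filter.2 ⟨mem_univ _, fun d hd => ?_⟩
        simp only [mem_insert, mem_singleton] at hd
        rcases hd with rfl | rfl | rfl
        · simp [hg]
        · simp [hg, hab.ne']
        · simp [hg, hca, hcb]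
    refine (card_le_card hsub).trans ((card_biUnion_le_card_mul _ _
      (Fintype.card β ^ (Fintype.card α - 3)) fun p hp => ?_).trans
        (Nat.mul_le_mul_right _ ?_))
    · have h3 := (mem_filter.1 (mem_product.1 hp).1).2
      exact (card_filter_embedding_le _ _).trans_eq (by rw [h3])
    · rw [hI, card_product]
      refine Nat.mul_le_mul_right _ ((card_le_univ _).trans_eq ?_)
      simp only [Fintype.card_prod]
      ring

/-- The vertices `x < n` whose quotient `x / r` lies in an interval of length `k`. -/
theorem card_le_of_forall_div {r n k m : ℕ} (hr : 0 < r) (B : Finset (Fin n))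
    (hB : ∀ x ∈ B, k ≤ (x : ℕ) / r ∧ (x : ℕ) / r < k + m) : #B ≤ r * m := by
  have h : #B ≤ #(range r ×ˢ Ico k (k + m)) := by
    refine card_le_card_of_injOn (fun x => ((x : ℕ) % r, (x : ℕ) / r)) (fun x hx => ?_) ?_
    · simpa [Nat.mod_lt _ hr] using hB x hx
    · intro x _ y _ hxy
      simp only [Prod.mk.injEq] at hxy
      exact Fin.ext (by rw [← Nat.mod_add_div x r, ← Nat.mod_add_div y r, hxy.1, hxy.2])
  simpa using h

/-- If the parts are balanced, they can be matched with the residue classes so that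
the larger parts correspond to the residues below `n % r`. -/
theorem exists_perm_of_balanced {r n : ℕ} (nv : Fin r → ℕ) (hsum : ∑ i, nv i = n)
    (hlo : ∀ i, n / r ≤ nv i) (hhi : ∀ i, nv i ≤ (n + r - 1) / r) :
    ∃ σ : Equiv.Perm (Fin r), ∀ c : Fin r, (c : ℕ) < n % r → n / r < nv (σ c) := by
  classical
  rcases Nat.eq_zero_or_pos r with rfl | hr
  · exact ⟨1, fun c => c.elim0⟩
  have hle : ∀ i, nv i = n / r + if n / r < nv i then 1 else 0 := by
    intro i
    have h1 := hlo i
    have h2 : (n + r - 1) / r ≤ n / r + 1 := by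
      rw [← Nat.add_div_right n hr]
      exact Nat.div_le_div_right (by omega)
    have h3 := hhi i
    split_ifs <;> omega
  have hcard : #{i : Fin r | n / r < nv i} = n % r := by
    have h := hsum
    rw [sum_congr rfl fun i _ => hle i, sum_add_distrib, ← card_filter] at h
    simp only [sum_const, card_univ, Fintype.card_fin, smul_eq_mul] at h
    have := Nat.div_add_mod n r
    omega
  have hcard' : #{i : Fin r | (i : ℕ) < n % r} = n % r := by
    rw [Fin.card_filter_val_lt]
    exact min_eq_right (Nat.mod_lt _ hr).le
  have e : {i : Fin r // (i : ℕ) < n % r} ≃ {i : Fin r // n / r < nv i} :=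
    Fintype.equivOfCardEq (by rw [Fintype.card_subtype, Fintype.card_subtype, hcard, hcard'])
  refine ⟨e.extendSubtype, fun c hc => e.extendSubtype_mem c hc⟩

theorem turanGraph_colorable {n r : ℕ} (hr : 0 < r) : (turanGraph n r).Colorable r :=
  ⟨Coloring.mk (fun x => ⟨(x : ℕ) % r, Nat.mod_lt _ hr⟩) fun {_ _} h he =>
    h (congrArg Fin.val he)⟩

/-- Comparison with a multipartite graph whose parts are matched with residue classes by `σ`:
the loss is controlled by the number of vertices of the Turán graph without a counterpart. -/
theorem critCount_le_critCountMulti_add {α : Type*} [Fintype α] {r n : ℕ} (hr : 0 < r)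
    {F : SimpleGraph α} (hF : ¬ F.Colorable r) (nv : Fin r → ℕ) (σ : Equiv.Perm (Fin r))
    (hn : 2 * r ≤ n) (h0 : 2 ≤ nv ⟨0, hr⟩) (bad : Finset (Fin n))
    (hbad : ∀ x : Fin n, x ∈ bad ↔ nv (σ ⟨(x : ℕ) % r, Nat.mod_lt _ hr⟩) ≤ (x : ℕ) / r) :
    critCount r n F ≤ critCountMulti r nv F +
      Fintype.card α ^ 3 * #bad * n ^ (Fintype.card α - 3) := by
  classical
  set c : Fin r := σ.symm ⟨0, hr⟩ with hc
  have hcr := c.2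
  have hσc : σ c = ⟨0, hr⟩ := σ.apply_symm_apply _
  set u : Fin n := ⟨c, by omega⟩ with hu
  set v : Fin n := ⟨c + r, by omega⟩ with hv
  have hum : (u : ℕ) % r = c := Nat.mod_eq_of_lt hcr
  have hvm : (v : ℕ) % r = c := by simp [hv, Nat.mod_eq_of_lt hcr]
  have hud : (u : ℕ) / r = 0 := Nat.div_eq_of_lt hcr
  have hvd : (v : ℕ) / r = 1 := by
    change ((c : ℕ) + r) / r = 1
    rw [Nat.add_div_right _ hr, Nat.div_eq_of_lt hcr]
  have huσ : σ ⟨(u : ℕ) % r, Nat.mod_lt _ hr⟩ = ⟨0, hr⟩ := by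
    rw [← hσc]; exact congrArg σ (Fin.ext hum)
  have hvσ : σ ⟨(v : ℕ) % r, Nat.mod_lt _ hr⟩ = ⟨0, hr⟩ := by
    rw [← hσc]; exact congrArg σ (Fin.ext hvm)
  have hub : u ∉ bad := by rw [hbad, huσ, hud]; omega
  have hvb : v ∉ bad := by rw [hbad, hvσ, hvd]; omega
  have huv : u ≠ v := fun h => by simp [hu, hv] at h; omega
  set φ : Fin n → Σ i : Fin r, Fin (nv i) := fun x =>
    if h : (x : ℕ) / r < nv (σ ⟨(x : ℕ) % r, Nat.mod_lt _ hr⟩) then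
      ⟨σ ⟨(x : ℕ) % r, Nat.mod_lt _ hr⟩, ⟨(x : ℕ) / r, h⟩⟩
    else ⟨⟨0, hr⟩, ⟨0, by omega⟩⟩
  have hφ1 : ∀ x ∉ bad, (φ x).1 = σ ⟨(x : ℕ) % r, Nat.mod_lt _ hr⟩ := by
    intro x hx
    rw [hbad, not_le] at hx
    exact congrArg Sigma.fst (dif_pos hx)
  have hφ2 : ∀ x ∉ bad, ((φ x).2 : ℕ) = (x : ℕ) / r := by
    intro x hx
    rw [hbad, not_le] at hx
    exact congrArg (fun y : Σ i : Fin r, Fin (nv i) => (y.2 : ℕ)) (dif_pos hx)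
  have hφ1' : ∀ x ∉ bad, ∀ y ∉ bad, (φ x).1 = (φ y).1 → (x : ℕ) % r = (y : ℕ) % r := by
    intro x hx y hy h
    rw [hφ1 x hx, hφ1 y hy] at h
    exact congrArg Fin.val (σ.injective h)
  have hinj : Set.InjOn φ {x | x ∉ bad} := by
    intro x hx y hy h
    have h1 := hφ1' x hx y hy (by rw [h])
    have h2 : (x : ℕ) / r = (y : ℕ) / r := by rw [← hφ2 x hx, ← hφ2 y hy, h]
    exact Fin.ext (by rw [← Nat.mod_add_div x r, ← Nat.mod_add_div y r, h1, h2])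
  have huv' : (multipartitePlusEdge r nv).Adj (φ u) (φ v) := by
    refine Or.inr ((fromEdgeSet_adj _).2 ⟨⟨φ u, φ v, ?_, ?_, ?_, ?_, rfl⟩,
      fun h => huv (hinj hub hvb h)⟩)
    · rw [hφ1 u hub, huσ]
    · rw [hφ1 v hvb, hvσ]
    · rw [hφ2 u hub, hud]
    · rw [hφ2 v hvb, hvd]
  have hadj : ∀ x ∉ bad, ∀ y ∉ bad, (turanGraph n r ⊔ fromEdgeSet {s(u, v)}).Adj x y →
      (multipartitePlusEdge r nv).Adj (φ x) (φ y) := by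
    intro x hx y hy h
    rw [sup_adj, fromEdgeSet_adj, Set.mem_singleton_iff, Sym2.eq_iff] at h
    rcases h with h | ⟨⟨rfl, rfl⟩ | ⟨rfl, rfl⟩, -⟩
    · exact Or.inl fun he => h (hφ1' x hx y hy he)
    · exact huv'
    · exact huv'.symm
  have key := card_copies_le_add hF (turanGraph_colorable hr) bad hub hvb φ hinj hadj
  rw [Fintype.card_fin] at key
  have hpos : 0 < Nat.card (F ≃g F) := by
    have : Finite (F ≃g F) := Finite.of_injective (fun e : F ≃g F => e.toEquiv)
      fun _ _ h => RelIso.toEquiv_injective h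
    exact Nat.card_pos
  have hmin : critCount r n F ≤ _root_.copyCount F (turanGraph n r ⊔ fromEdgeSet {s(u, v)}) :=
    Nat.sInf_le ⟨u, v, huv, hum.trans hvm.symm, rfl⟩
  refine hmin.trans ((Nat.div_le_div_right key).trans ?_)
  rw [critCountMulti, _root_.copyCount, ← Nat.add_mul_div_left _ _ hpos]
  exact Nat.div_le_div_right (Nat.add_le_add_left (Nat.le_mul_of_pos_left _ hpos) _)

/-- There is `γ_F > 0` such that for all large `n`: if `n₁ + ⋯ + n_r = n`
with `⌊n/r⌋ − s ≤ n_i ≤ ⌈n/r⌉ + s` for all `i` and `s < n/(3r)`, then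
`c(n₁, …, n_r, F) ≥ c(n,F) − γ_F s n^{f−3}`. -/
theorem critCountMulti_lower_bound {α : Type} [Fintype α] (r : ℕ) (hr : 2 ≤ r)
    (F : SimpleGraph α) (hF : IsCriticalGraph r F) :
    ∃ γF : ℝ, 0 < γF ∧ ∃ n₀ : ℕ, ∀ n : ℕ, n₀ < n → ∀ s : ℕ, ∀ nv : Fin r → ℕ,
      (∑ i, nv i) = n →
      (∀ i, n / r - s ≤ nv i ∧ nv i ≤ (n + r - 1) / r + s) →
      (s : ℝ) < (n : ℝ) / (3 * r) →
      (critCount r n F : ℝ) - γF * s * (n : ℝ) ^ (Fintype.card α - 3) ≤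
        (critCountMulti r nv F : ℝ) := by
  have hr0 : 0 < r := by omega
  have hcol : ¬ F.Colorable r := fun h => by
    have h' := h.chromaticNumber_le
    rw [hF.1, Nat.cast_le] at h'
    omega
  refine ⟨Fintype.card α ^ 3 * (r * 2) + 1, by positivity, 6 * r, ?_⟩
  intro n hn s nv hsum hnv hs
  have hq : 6 ≤ n / r := (Nat.le_div_iff_mul_le hr0).2 hn.le
  have hs3 : s * 3 ≤ n / r := by
    rw [Nat.le_div_iff_mul_le hr0]
    rw [lt_div_iff₀ (by positivity)] at hs
    have : s * (3 * r) < n := by exact_mod_cast hs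
    linarith
  obtain ⟨σ, hσ⟩ : ∃ σ : Equiv.Perm (Fin r), s = 0 → ∀ c : Fin r, (c : ℕ) < n % r →
      n / r < nv (σ c) := by
    by_cases h : s = 0
    · subst h
      obtain ⟨σ, hσ⟩ := exists_perm_of_balanced nv hsum (fun i => (hnv i).1)
        (fun i => (hnv i).2)
      exact ⟨σ, fun _ => hσ⟩
    · exact ⟨1, fun h' => absurd h' h⟩
  set bad : Finset (Fin n) :=
    {x | nv (σ ⟨(x : ℕ) % r, Nat.mod_lt _ hr0⟩) ≤ (x : ℕ) / r} with hbad
  have hcard : #bad ≤ r * (2 * s) := by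
    refine card_le_of_forall_div (k := n / r - s) hr0 bad fun x hx => ?_
    have hx' := (mem_filter.1 hx).2
    have hlo := (hnv (σ ⟨(x : ℕ) % r, Nat.mod_lt _ hr0⟩)).1
    have hxn : (x : ℕ) / r ≤ n / r := Nat.div_le_div_right x.2.le
    refine ⟨by omega, ?_⟩
    rcases Nat.eq_zero_or_pos s with h | h
    · exfalso
      have hxq : (x : ℕ) / r = n / r := by omega
      have hxr : (x : ℕ) % r < n % r := by
        have h1 := Nat.mod_add_div (x : ℕ) r
        have h2 := Nat.mod_add_div n r
        rw [hxq] at h1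
        have := x.2
        omega
      have := hσ h ⟨(x : ℕ) % r, Nat.mod_lt _ hr0⟩ hxr
      omega
    · omega
  have key := critCount_le_critCountMulti_add hr0 hcol nv σ (by omega)
    (by have := (hnv ⟨0, hr0⟩).1; omega) bad (fun x => by simp [hbad])
  have hle : critCount r n F ≤ critCountMulti r nv F +
      (Fintype.card α ^ 3 * (r * 2) + 1) * s * n ^ (Fintype.card α - 3) := by
    refine key.trans (Nat.add_le_add_left (Nat.mul_le_mul_right _ ?_) _)
    calc Fintype.card α ^ 3 * #bad ≤ Fintype.card α ^ 3 * (r * (2 * s)) :=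
          Nat.mul_le_mul_left _ hcard
      _ ≤ (Fintype.card α ^ 3 * (r * 2) + 1) * s := by nlinarith
  rw [sub_le_iff_le_add]
  exact_mod_cast hle
end

section
/- Fix k ≥ 1 and let F = C_{2k+1} be the odd cycle on 2k+1 vertices. Then for all sufficiently large n, c(n,F) = ⌊n/2⌋·(⌊n/2⌋ − 1)⋯(⌊n/2⌋ − k + 1)·(⌈n/2⌉ − 2)·(⌈n/2⌉ − 3)⋯(⌈n/2⌉ − k), where the second product is interpreted as empty (equal to 1) when k = 1. -/
open SimpleGraph Finset

/-- The embeddings of `F` into `H` that preserve edges. -/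
abbrev EdgeEmbedding {α β : Type*} (F : SimpleGraph α) (H : SimpleGraph β) : Type _ :=
  {f : α ↪ β // ∀ ⦃u v⦄, F.Adj u v → H.Adj (f u) (f v)}

section Cycle

variable {N : ℕ}

lemma cycleGraph_adj_iff_eq_add_one {i j : Fin (N + 2)} :
    (cycleGraph (N + 2)).Adj i j ↔ i = j + 1 ∨ j = i + 1 := by
  rw [cycleGraph_adj, sub_eq_iff_eq_add', sub_eq_iff_eq_add', add_comm j, add_comm i,
    add_comm 1, add_comm 1]

open Fin.NatCast in
/-- An automorphism of a cycle that fixes an arc is trivial. -/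
lemma cycleGraph_iso_apply_eq_self (σ : cycleGraph (N + 3) ≃g cycleGraph (N + 3))
    (h0 : σ 0 = 0) (h1 : σ 1 = 1) (x : Fin (N + 3)) : σ x = x := by
  have key : ∀ i : ℕ, σ (i : Fin (N + 3)) = i ∧ σ ((i : Fin (N + 3)) + 1) = i + 1 := by
    intro i
    induction i with
    | zero => simp [h0, h1]
    | succ i ih =>
      push_cast
      refine ⟨ih.2, ?_⟩
      have hadj : (cycleGraph (N + 3)).Adj ((i : Fin (N + 3)) + 1) (i + 1 + 1) :=
        cycleGraph_adj_iff_eq_add_one.2 (Or.inr rfl)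
      have := cycleGraph_adj_iff_eq_add_one.1 (σ.map_adj_iff.2 hadj)
      rw [ih.2] at this
      rcases this with h | h
      · have h' : σ (i + 1 + 1) = σ i := by rw [ih.1]; exact (add_right_cancel h).symm
        have h2 := σ.injective h'
        rw [add_assoc, add_eq_left] at h2
        exact absurd (congrArg Fin.val h2) (by simp [Fin.val_add, Nat.mod_eq_of_lt])
      · exact h
  have := (key x).1
  rwa [Fin.cast_val_eq_self] at this

/-- The automorphism group of a cycle is transitive on arcs. -/
lemma exists_cycleGraph_iso {i j : Fin (N + 3)} (h : (cycleGraph (N + 3)).Adj i j) :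
    ∃ σ : cycleGraph (N + 3) ≃g cycleGraph (N + 3), σ 0 = i ∧ σ 1 = j := by
  rcases cycleGraph_adj_iff_eq_add_one.1 h with h | h
  · refine ⟨⟨Equiv.subLeft i, ?_⟩, ?_, ?_⟩
    · intro a b
      simp only [cycleGraph_adj, Equiv.subLeft_apply, sub_sub_sub_cancel_left]
      exact or_comm
    · change i - 0 = i
      simp
    · change i - 1 = j
      simp [h]
  · refine ⟨⟨Equiv.addLeft i, ?_⟩, ?_, ?_⟩
    · intro a b
      simp [cycleGraph_adj]
    · change i + 0 = i
      simp
    · exact h.symm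

/-- The edge-preserving embeddings of a cycle that send the arc `(0, 1)` to `(u, v)`. -/
abbrev RootedEmbedding {β : Type*} (N : ℕ) (H : SimpleGraph β) (u v : β) : Type _ :=
  {f : EdgeEmbedding (cycleGraph (N + 3)) H // f.1 0 = u ∧ f.1 1 = v}

/-- If every embedded cycle passes through the edge `uv`, then the number of copies of the cycle
is the number of embeddings rooted at `(u, v)`. -/
lemma copyCount_cycleGraph_eq_card_rooted {β : Type*} (H : SimpleGraph β) {u v : β}
    (huv : ∀ f : EdgeEmbedding (cycleGraph (N + 3)) H,
      ∃ i j, (cycleGraph (N + 3)).Adj i j ∧ f.1 i = u ∧ f.1 j = v) :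
    _root_.copyCount (cycleGraph (N + 3)) H = Nat.card (RootedEmbedding N H u v) := by
  let φ : RootedEmbedding N H u v × (cycleGraph (N + 3) ≃g cycleGraph (N + 3)) →
      EdgeEmbedding (cycleGraph (N + 3)) H := fun p =>
    ⟨p.2.toEquiv.toEmbedding.trans p.1.1.1, fun a b hab => p.1.1.2 (p.2.map_adj_iff.2 hab)⟩
  have hφ : ∀ p x, (φ p).1 x = p.1.1.1 (p.2 x) := fun _ _ => rfl
  have hbij : Function.Bijective φ := by
    constructor
    · rintro p q h
      have hx : ∀ x, p.1.1.1 (p.2 x) = q.1.1.1 (q.2 x) := fun x => by rw [← hφ, ← hφ, h]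
      have hσ : ∀ y, q.2 (p.2.symm y) = y := by
        apply cycleGraph_iso_apply_eq_self (p.2.symm.trans q.2)
        · apply q.1.1.1.injective
          change q.1.1.1 (q.2 (p.2.symm 0)) = _
          rw [← hx, p.2.apply_symm_apply, p.1.2.1, q.1.2.1]
        · apply q.1.1.1.injective
          change q.1.1.1 (q.2 (p.2.symm 1)) = _
          rw [← hx, p.2.apply_symm_apply, p.1.2.2, q.1.2.2]
      refine Prod.ext (Subtype.ext (Subtype.ext (DFunLike.ext _ _ fun y => ?_)))
        (DFunLike.ext _ _ fun y => ?_)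
      · have := hx (p.2.symm y)
        rwa [p.2.apply_symm_apply, hσ] at this
      · have := hσ (p.2 y)
        rw [p.2.symm_apply_apply] at this
        exact this.symm
    · intro f
      obtain ⟨i, j, hij, hi, hj⟩ := huv f
      obtain ⟨σ, h0, h1⟩ := exists_cycleGraph_iso hij
      refine ⟨⟨⟨⟨σ.toEquiv.toEmbedding.trans f.1, fun a b hab => f.2 (σ.map_adj_iff.2 hab)⟩,
        ?_, ?_⟩, σ.symm⟩, ?_⟩
      · change f.1 (σ 0) = u
        rw [h0, hi]
      · change f.1 (σ 1) = v
        rw [h1, hj]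
      · refine Subtype.ext (DFunLike.ext _ _ fun y => ?_)
        change f.1 (σ (σ.symm y)) = _
        rw [σ.apply_symm_apply]
  have : Finite (cycleGraph (N + 3) ≃g cycleGraph (N + 3)) :=
    Finite.of_injective _ (DFunLike.coe_injective)
  have : Nonempty (cycleGraph (N + 3) ≃g cycleGraph (N + 3)) := ⟨RelIso.refl _⟩
  rw [_root_.copyCount, ← Nat.card_eq_of_bijective φ hbij, Nat.card_prod,
    Nat.mul_div_cancel _ Nat.card_pos]

end Cycle

section NearlyBipartite

variable {β : Type*} {H : SimpleGraph β} {c : β → Bool} {u v : β} {m : ℕ}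

open Fin.CommRing in
/-- An odd cycle in a bipartite graph plus the edge `uv` passes through `uv`. -/
lemma exists_adj_apply_eq_of_odd_cycle
    (hH : ∀ x y, H.Adj x y → c x ≠ c y ∨ (x = u ∧ y = v) ∨ (x = v ∧ y = u))
    (f : EdgeEmbedding (cycleGraph (2 * m + 3)) H) :
    ∃ i j, (cycleGraph (2 * m + 3)).Adj i j ∧ f.1 i = u ∧ f.1 j = v := by
  by_contra! hne
  have hstep : ∀ i : Fin (2 * m + 3), c (f.1 (i + 1)) = !c (f.1 i) := by
    intro i
    have hadj : (cycleGraph (2 * m + 3)).Adj i (i + 1) :=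
      cycleGraph_adj_iff_eq_add_one.2 (Or.inr rfl)
    rcases hH _ _ (f.2 hadj) with h | ⟨h1, h2⟩ | ⟨h1, h2⟩
    · exact Bool.eq_not.2 h.symm
    · exact absurd h2 (hne _ _ hadj h1)
    · exact absurd h1 (hne _ _ hadj.symm h2)
  have key : ∀ i : ℕ, c (f.1 ((2 * i : ℕ) : Fin (2 * m + 3))) = c (f.1 0) := by
    intro i
    induction i with
    | zero => simp
    | succ i ih =>
      have : ((2 * (i + 1) : ℕ) : Fin (2 * m + 3)) = ((2 * i : ℕ) : Fin (2 * m + 3)) + 1 + 1 := by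
        push_cast
        ring
      rw [this, hstep, hstep, ih, Bool.not_not]
  have h1 := hstep ((2 * (m + 1) : ℕ) : Fin (2 * m + 3))
  have h2 : ((2 * (m + 1) : ℕ) : Fin (2 * m + 3)) + 1 = 0 := by
    have := Fin.natCast_self (2 * m + 3)
    rw [← this]
    push_cast
    ring
  rw [h2, key] at h1
  simp at h1

/-- Along an odd cycle rooted at the arc `(u, v)`, the colours alternate except on that arc. -/
lemma RootedEmbedding.color_eq_iff
    (hH : ∀ x y, H.Adj x y → c x ≠ c y ∨ (x = u ∧ y = v) ∨ (x = v ∧ y = u)) (hc : c u = c v)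
    (f : RootedEmbedding (2 * m) H u v) (j : ℕ) (hj : j + 1 < 2 * m + 3) :
    c (f.1.1 ⟨j + 1, hj⟩) = c u ↔ j % 2 = 0 := by
  induction j with
  | zero =>
    have : (⟨0 + 1, hj⟩ : Fin (2 * m + 3)) = 1 := by ext; simp
    simp [this, f.2.2, hc]
  | succ j ih =>
    have ih := ih (by omega)
    have hadj : (cycleGraph (2 * m + 3)).Adj ⟨j + 1, by omega⟩ ⟨j + 1 + 1, hj⟩ := by
      rw [cycleGraph_adj_iff_eq_add_one]
      right
      ext
      rw [Fin.val_add_one_of_lt (by simp [Fin.lt_def]; omega)]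
    have hne : ∀ i : ℕ, ∀ hi : i + 1 < 2 * m + 3, f.1.1 ⟨i + 1, hi⟩ ≠ u := by
      intro i hi h
      simpa using congrArg Fin.val (f.1.1.injective (h.trans f.2.1.symm))
    rcases hH _ _ (f.1.2 hadj) with h | ⟨h, -⟩ | ⟨-, h⟩
    · have : c (f.1.1 ⟨j + 1 + 1, hj⟩) = c u ↔ ¬ c (f.1.1 ⟨j + 1, by omega⟩) = c u := by
        revert h
        generalize c (f.1.1 ⟨j + 1 + 1, hj⟩) = x
        generalize c (f.1.1 ⟨j + 1, _⟩) = y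
        generalize c u = z
        revert x y z
        decide
      rw [this, ih]
      omega
    · exact absurd h (hne _ _)
    · exact absurd h (hne _ _)

/-- The vertices of the cycle `u v g₀ h₀ g₁ h₁ … gₘ`. -/
def interleave (u v : β) (g : Fin (m + 1) → β) (h : Fin m → β) (i : Fin (2 * m + 3)) : β :=
  if i.val = 0 then u else if hi : i.val ≤ 1 then v else
    if hi' : i.val % 2 = 0 then g ⟨i.val / 2 - 1, by omega⟩ else h ⟨i.val / 2 - 1, by omega⟩

lemma interleave_even (u v : β) (g : Fin (m + 1) → β) (h : Fin m → β) (j : ℕ)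
    (hj : 2 * j + 2 < 2 * m + 3) :
    interleave u v g h ⟨2 * j + 2, hj⟩ = g ⟨j, by omega⟩ := by
  simp only [interleave]
  rw [if_neg (by omega), dif_neg (by omega), dif_pos (by omega)]
  congr 2
  omega

lemma interleave_odd (u v : β) (g : Fin (m + 1) → β) (h : Fin m → β) (j : ℕ)
    (hj : 2 * j + 3 < 2 * m + 3) :
    interleave u v g h ⟨2 * j + 3, hj⟩ = h ⟨j, by omega⟩ := by
  simp only [interleave]
  rw [if_neg (by omega), dif_neg (by omega), dif_neg (by omega)]
  congr 2
  omega

lemma fin_cycle_cases (i : Fin (2 * m + 3)) :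
    i = 0 ∨ i = 1 ∨ (∃ j, ∃ hj : 2 * j + 2 < 2 * m + 3, i = ⟨2 * j + 2, hj⟩) ∨
      ∃ j, ∃ hj : 2 * j + 3 < 2 * m + 3, i = ⟨2 * j + 3, hj⟩ := by
  obtain ⟨i, hi⟩ := i
  match i, hi with
  | 0, _ => exact Or.inl rfl
  | 1, _ => exact Or.inr (Or.inl (by ext; simp))
  | i + 2, hi =>
    rcases Nat.even_or_odd' i with ⟨j, rfl | rfl⟩
    · exact Or.inr (Or.inr (Or.inl ⟨j, hi, rfl⟩))
    · exact Or.inr (Or.inr (Or.inr ⟨j, hi, rfl⟩))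

/-- An odd cycle rooted at the arc `(u, v)` is given by its vertices in either part. -/
def rootedEmbeddingEquiv
    (hH : ∀ x y, H.Adj x y ↔ c x ≠ c y ∨ (x = u ∧ y = v) ∨ (x = v ∧ y = u))
    (huv : u ≠ v) (hc : c u = c v) :
    RootedEmbedding (2 * m) H u v ≃
      (Fin (m + 1) ↪ {x // c x ≠ c u}) × (Fin m ↪ {x // c x = c u ∧ x ≠ u ∧ x ≠ v}) where
  toFun f :=
    (⟨fun j => ⟨f.1.1 ⟨2 * j + 2, by omega⟩, fun h => by
        have := (f.color_eq_iff (fun x y => (hH x y).1) hc (2 * j + 1) (by omega)).1 h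
        omega⟩, fun i j hij => by
        have := congrArg Fin.val (f.1.1.injective (congrArg Subtype.val hij))
        ext
        simpa using this⟩,
      ⟨fun j => ⟨f.1.1 ⟨2 * j + 3, by omega⟩,
        (f.color_eq_iff (fun x y => (hH x y).1) hc (2 * j + 2) (by omega)).2 (by omega),
        fun h => by
          simpa using congrArg Fin.val (f.1.1.injective (h.trans f.2.1.symm)),
        fun h => by
          simpa using congrArg Fin.val (f.1.1.injective (h.trans f.2.2.symm))⟩, fun i j hij => by
        have := congrArg Fin.val (f.1.1.injective (congrArg Subtype.val hij))
        ext
        simpa using this⟩)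
  invFun p :=
    have h0 : interleave u v (fun j => (p.1 j).1) (fun j => (p.2 j).1) 0 = u := by
      simp [interleave]
    have h1 : interleave u v (fun j => (p.1 j).1) (fun j => (p.2 j).1) 1 = v := by
      simp [interleave]
    ⟨⟨⟨interleave u v (fun j => (p.1 j).1) (fun j => (p.2 j).1), by
      intro a b hab
      have hg : ∀ j, (p.1 j).1 ≠ u ∧ (p.1 j).1 ≠ v ∧ ∀ i, (p.1 j).1 ≠ (p.2 i).1 := fun j =>
        ⟨fun h => (p.1 j).2 (congrArg c h), fun h => (p.1 j).2 ((congrArg c h).trans hc.symm),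
          fun i h => (p.1 j).2 ((congrArg c h).trans (p.2 i).2.1)⟩
      have hh : ∀ j, (p.2 j).1 ≠ u ∧ (p.2 j).1 ≠ v := fun j => (p.2 j).2.2
      have hgi : ∀ i j, (p.1 i).1 = (p.1 j).1 → i = j :=
        fun i j h => p.1.injective (Subtype.ext h)
      have hhi : ∀ i j, (p.2 i).1 = (p.2 j).1 → i = j :=
        fun i j h => p.2.injective (Subtype.ext h)
      rcases fin_cycle_cases a with rfl | rfl | ⟨i, hi, rfl⟩ | ⟨i, hi, rfl⟩ <;>
      rcases fin_cycle_cases b with rfl | rfl | ⟨j, hj, rfl⟩ | ⟨j, hj, rfl⟩ <;>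
      simp only [h0, h1, interleave_even, interleave_odd] at hab <;>
      grind⟩, by
      have hstep : ∀ i, H.Adj
          (interleave u v (fun j => (p.1 j).1) (fun j => (p.2 j).1) i)
          (interleave u v (fun j => (p.1 j).1) (fun j => (p.2 j).1) (i + 1)) := by
        intro i
        rw [hH]
        rcases fin_cycle_cases i with rfl | rfl | ⟨i, hi, rfl⟩ | ⟨i, hi, rfl⟩
        · rw [zero_add, h0, h1]
          simp
        · have : (1 : Fin (2 * m + 3)) + 1 = ⟨2 * 0 + 2, by omega⟩ := by
            ext
            simp [Fin.val_add, Nat.mod_eq_of_lt]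
          rw [this, h1, interleave_even, ← hc]
          exact Or.inl (p.1 _).2.symm
        · by_cases hm : i < m
          · have : (⟨2 * i + 2, hi⟩ : Fin (2 * m + 3)) + 1 = ⟨2 * i + 3, by omega⟩ := by
              ext
              rw [Fin.val_add_one_of_lt (by simp [Fin.lt_def]; omega)]
            rw [this, interleave_even, interleave_odd, (p.2 _).2.1]
            exact Or.inl (p.1 _).2
          · have : (⟨2 * i + 2, hi⟩ : Fin (2 * m + 3)) + 1 = 0 := by
              obtain rfl : i = m := by omega
              exact Fin.last_add_one _
            rw [this, interleave_even, h0]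
            exact Or.inl (p.1 _).2
        · have : (⟨2 * i + 3, hi⟩ : Fin (2 * m + 3)) + 1 = ⟨2 * (i + 1) + 2, by omega⟩ := by
            ext
            rw [Fin.val_add_one_of_lt (by simp [Fin.lt_def]; omega)]
            simp only
            ring
          rw [this, interleave_even, interleave_odd, (p.2 _).2.1]
          exact Or.inl (p.1 _).2.symm
      intro a b hab
      rcases cycleGraph_adj_iff_eq_add_one.1 hab with rfl | rfl
      · exact (hstep b).symm
      · exact hstep a⟩, h0, h1⟩
  left_inv f := by
    refine Subtype.ext (Subtype.ext (DFunLike.ext _ _ fun y => ?_))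
    change interleave u v (fun j : Fin (m + 1) => f.1.1 ⟨2 * j + 2, by omega⟩)
      (fun j : Fin m => f.1.1 ⟨2 * j + 3, by omega⟩) y = f.1.1 y
    rcases fin_cycle_cases y with rfl | rfl | ⟨i, hi, rfl⟩ | ⟨i, hi, rfl⟩
    · simp [interleave, f.2.1]
    · simp [interleave, f.2.2]
    · rw [interleave_even]
    · rw [interleave_odd]
  right_inv p := by
    refine Prod.ext (DFunLike.ext _ _ fun j => Subtype.ext ?_)
      (DFunLike.ext _ _ fun j => Subtype.ext ?_)
    · exact interleave_even u v (fun j => (p.1 j).1) (fun j => (p.2 j).1) j (by omega)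
    · exact interleave_odd u v (fun j => (p.1 j).1) (fun j => (p.2 j).1) j (by omega)

/-- The number of copies of an odd cycle in a complete bipartite graph plus the edge `uv`. -/
lemma copyCount_odd_cycle [Finite β]
    (hH : ∀ x y, H.Adj x y ↔ c x ≠ c y ∨ (x = u ∧ y = v) ∨ (x = v ∧ y = u))
    (huv : u ≠ v) (hc : c u = c v) :
    _root_.copyCount (cycleGraph (2 * m + 3)) H =
      (Nat.card {x // c x ≠ c u}).descFactorial (m + 1) *
        (Nat.card {x // c x = c u} - 2).descFactorial m := by
  classical
  have := Fintype.ofFinite β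
  have hcard : Nat.card {x // c x = c u ∧ x ≠ u ∧ x ≠ v} = Nat.card {x // c x = c u} - 2 := by
    simp only [Nat.card_eq_fintype_card, Fintype.card_subtype]
    rw [← Finset.card_pair huv, ← Finset.card_sdiff_of_subset]
    · congr 1
      ext x
      simp
    · intro x
      simp only [Finset.mem_insert, Finset.mem_singleton, Finset.mem_filter_univ]
      rintro (rfl | rfl)
      exacts [rfl, hc.symm]
  rw [copyCount_cycleGraph_eq_card_rooted H
      (exists_adj_apply_eq_of_odd_cycle fun x y => (hH x y).1),
    Nat.card_congr (rootedEmbeddingEquiv hH huv hc), Nat.card_prod, ← hcard]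
  simp only [Nat.card_eq_fintype_card, Fintype.card_embedding_eq, Fintype.card_fin]

end NearlyBipartite

section Turan

/-- The number of vertices in each part of the Turán graph `T_2(n)`. -/
lemma card_fin_mod_two_eq (n r : ℕ) (hr : r < 2) :
    Nat.card {x : Fin n // x.val % 2 = r} = (n + 1 - r) / 2 := by
  let e : {x : Fin n // x.val % 2 = r} ≃ Fin ((n + 1 - r) / 2) :=
    { toFun := fun x => ⟨x.1.val / 2, by have := x.2; omega⟩
      invFun := fun i => ⟨⟨2 * i + r, by omega⟩, by simp; omega⟩
      left_inv := fun x => by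
        have := x.2
        ext
        simp only
        omega
      right_inv := fun i => by
        ext
        simp only
        omega }
  rw [Nat.card_congr e, Nat.card_fin]

lemma copyCount_odd_cycle_turanGraph_sup_edge (m n : ℕ) {u v : Fin n} (huv : u ≠ v)
    (hmod : (u : ℕ) % 2 = (v : ℕ) % 2) :
    _root_.copyCount (cycleGraph (2 * m + 3)) (turanGraph n 2 ⊔ fromEdgeSet {s(u, v)}) =
      ((n + (u : ℕ) % 2) / 2).descFactorial (m + 1) *
        ((n + 1 - (u : ℕ) % 2) / 2 - 2).descFactorial m := by
  let c : Fin n → Bool := fun x => decide (x.val % 2 = 0)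
  have hcol : ∀ x y : Fin n, c x = c y ↔ x.val % 2 = y.val % 2 := by
    intro x y
    simp only [c, decide_eq_decide]
    omega
  rw [copyCount_odd_cycle (c := c) (u := u) (v := v) ?_ huv ((hcol u v).2 hmod)]
  · have h1 : Nat.card {x // c x ≠ c u} = (n + (u : ℕ) % 2) / 2 := by
      have : ∀ x : Fin n, c x ≠ c u ↔ x.val % 2 = 1 - (u : ℕ) % 2 := by
        intro x
        rw [Ne, hcol]
        omega
      simp only [this]
      rw [card_fin_mod_two_eq n _ (by omega)]
      congr 1
      omega
    have h2 : Nat.card {x // c x = c u} = (n + 1 - (u : ℕ) % 2) / 2 := by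
      simp only [hcol]
      rw [card_fin_mod_two_eq n _ (by omega)]
    rw [h1, h2]
  · intro x y
    have hxy := hcol x y
    rw [sup_adj, turanGraph_adj, fromEdgeSet_adj, Set.mem_singleton_iff, Sym2.eq_iff]
    grind

/-- Placing the extra edge inside the larger part gives the fewer copies. -/
lemma descFactorial_mul_le_descFactorial_mul {m M : ℕ} (hM : m + 3 ≤ M) (hm : 2 * m + 1 ≤ M) :
    M.descFactorial (m + 1) * (M - 1).descFactorial m ≤
      (M + 1).descFactorial (m + 1) * (M - 2).descFactorial m := by
  cases m with
  | zero => simp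
  | succ p =>
    obtain ⟨d, rfl⟩ := Nat.exists_eq_add_of_le hM
    have h1 : p + 1 + 3 + d - 1 = (p + 1 + 3 + d - 2) + 1 := by omega
    rw [Nat.descFactorial_succ, Nat.succ_descFactorial_succ (p + 1 + 3 + d) (p + 1), h1,
      Nat.succ_descFactorial_succ, Nat.descFactorial_succ (p + 1 + 3 + d - 2) p]
    have h2 : p + 1 + 3 + d - (p + 1) = d + 3 := by omega
    have h3 : p + 1 + 3 + d - 2 - p = d + 2 := by omega
    have h4 : p + 1 + 3 + d - 2 + 1 = p + d + 3 := by omega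
    rw [h2, h3, h4]
    have h5 : (d + 3) * (p + d + 3) ≤ (p + 1 + 3 + d + 1) * (d + 2) := by nlinarith
    calc _ = ((d + 3) * (p + d + 3)) * ((p + 1 + 3 + d).descFactorial (p + 1) *
          (p + 1 + 3 + d - 2).descFactorial p) := by ring
      _ ≤ _ := Nat.mul_le_mul_right _ h5
      _ = _ := by ring

lemma prod_Icc_two_sub_eq_descFactorial (a m : ℕ) :
    ∏ j ∈ Finset.Icc 2 (m + 1), (a - j) = (a - 2).descFactorial m := by
  rw [Nat.descFactorial_eq_prod_range, ← Finset.Ico_succ_right_eq_Icc,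
    Finset.prod_Ico_eq_prod_range]
  exact Finset.prod_congr rfl fun j _ => by omega

end Turan

/-- For `k ≥ 1` and all sufficiently large `n`,
`c(n, C_{2k+1}) = ⌊n/2⌋(⌊n/2⌋−1)⋯(⌊n/2⌋−k+1) · (⌈n/2⌉−2)(⌈n/2⌉−3)⋯(⌈n/2⌉−k)`. -/
theorem critCount_odd_cycle (k : ℕ) (hk : 1 ≤ k) :
    ∃ n₀ : ℕ, ∀ n : ℕ, n₀ < n →
      critCount 2 n (SimpleGraph.cycleGraph (2 * k + 1)) =
        (∏ j ∈ Finset.range k, (n / 2 - j)) * ∏ j ∈ Finset.Icc 2 k, ((n + 1) / 2 - j) := by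
  obtain ⟨m, rfl⟩ := Nat.exists_eq_add_of_le' hk
  refine ⟨4 * m + 10, fun n hn => ?_⟩
  rw [prod_Icc_two_sub_eq_descFactorial, ← Nat.descFactorial_eq_prod_range]
  have h02 : (⟨0, by omega⟩ : Fin n) ≠ ⟨2, by omega⟩ := by simp
  refine IsLeast.csInf_eq ⟨⟨_, _, h02, by simp, ?_⟩, ?_⟩
  · exact (copyCount_odd_cycle_turanGraph_sup_edge m n h02 (by simp)).symm
  · rintro _ ⟨u, v, huv, hmod, rfl⟩
    refine le_of_le_of_eq ?_ (copyCount_odd_cycle_turanGraph_sup_edge m n huv hmod).symm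
    rcases Nat.mod_two_eq_zero_or_one (u : ℕ) with hu | hu
    · simp [hu]
    · rw [hu, Nat.add_sub_cancel]
      rcases Nat.even_or_odd' n with ⟨M, rfl | rfl⟩
      · have : (2 * M + 1) / 2 = 2 * M / 2 := by omega
        rw [this]
      · have h1 : (2 * M + 1) / 2 = M := by omega
        have h2 : (2 * M + 1 + 1) / 2 = M + 1 := by omega
        rw [h1, h2]
        exact descFactorial_mul_le_descFactorial_mul (by omega) (by omega)
end

section
/- Let F be the graph obtained from the complete graph K_4 by deleting one edge. Then for all sufficiently large n, c(n,F) = binom(⌊n/2⌋, 2). -/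
open SimpleGraph Finset

/-- `K₄` minus one edge. -/
def K4minusEdge : SimpleGraph (Fin 4) := (⊤ : SimpleGraph (Fin 4)).deleteEdges {s(0, 1)}

theorem K4minusEdge_adj {a b : Fin 4} :
    K4minusEdge.Adj a b ↔ a ≠ b ∧ s(a, b) ≠ s(0, 1) := by
  simp [K4minusEdge]

instance : DecidableRel K4minusEdge.Adj := fun _ _ => decidable_of_iff' _ K4minusEdge_adj

theorem card_K4minusEdge_iso : Nat.card (K4minusEdge ≃g K4minusEdge) = 4 := by
  have e : (K4minusEdge ≃g K4minusEdge) ≃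
      {p : Equiv.Perm (Fin 4) // ∀ a b, K4minusEdge.Adj (p a) (p b) ↔ K4minusEdge.Adj a b} :=
    { toFun := fun g => ⟨g.toEquiv, fun _ _ => g.map_rel_iff⟩
      invFun := fun p => ⟨p.1, fun {a b} => p.2 a b⟩
      left_inv := fun _ => rfl
      right_inv := fun _ => rfl }
  rw [Nat.card_congr e, Nat.card_eq_fintype_card]
  decide

/-- Adjacency in the balanced complete bipartite graph with the extra edge `uv`. -/
theorem turanGraph_two_sup_edge_adj {n : ℕ} {u v a b : Fin n} :
    (turanGraph n 2 ⊔ fromEdgeSet {s(u, v)}).Adj a b ↔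
      (a : ℕ) % 2 ≠ (b : ℕ) % 2 ∨ ((a = u ∧ b = v ∨ a = v ∧ b = u) ∧ a ≠ b) := by
  simp [turanGraph]

theorem card_filter_mod_two_ne (n k : ℕ) :
    #{a : Fin n | (a : ℕ) % 2 ≠ k % 2} = (n + k % 2) / 2 := by
  rw [card_filter, Fin.sum_univ_eq_sum_range (fun a => if a % 2 ≠ k % 2 then 1 else 0)]
  induction n with
  | zero => simp
  | succ n ih =>
    rw [sum_range_succ, ih]
    split_ifs <;> omega

/-- Both triangles of a copy of `K₄ - e` contain the extra edge, which is thus the image of the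
edge they share; the two remaining vertices are arbitrary in the opposite part. -/
theorem copyCount_K4minusEdge {n : ℕ} {u v : Fin n} (huv : u ≠ v)
    (hmod : (u : ℕ) % 2 = (v : ℕ) % 2) :
    _root_.copyCount K4minusEdge (turanGraph n 2 ⊔ fromEdgeSet {s(u, v)}) =
      ((n + (u : ℕ) % 2) / 2).choose 2 := by
  classical
  set H := turanGraph n 2 ⊔ fromEdgeSet {s(u, v)} with hH
  set B : Finset (Fin n) := {a : Fin n | (a : ℕ) % 2 ≠ (u : ℕ) % 2} with hB
  let φ : (Fin 4 ↪ Fin n) → (Fin n × Fin n) × (Fin n × Fin n) :=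
    fun f => ((f 0, f 1), (f 2, f 3))
  have hφ : Function.Injective φ := by
    intro f g h
    simp only [φ, Prod.mk.injEq] at h
    ext i
    fin_cases i <;> simp [h]
  have himage : φ '' {f | ∀ ⦃a b⦄, K4minusEdge.Adj a b → H.Adj (f a) (f b)} =
      ↑(B.offDiag ×ˢ ({(u, v), (v, u)} : Finset (Fin n × Fin n))) := by
    ext ⟨⟨b, b'⟩, ⟨x, y⟩⟩
    simp only [Set.mem_image, Set.mem_ofPred_eq, φ, Prod.mk.injEq, coe_product, Set.mem_prod,
      mem_coe, mem_offDiag, hB, mem_filter, mem_univ, true_and, mem_insert, mem_singleton]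
    constructor
    · rintro ⟨f, hf, ⟨rfl, rfl⟩, rfl, rfl⟩
      have h02 := turanGraph_two_sup_edge_adj.1 (@hf 0 2 (by decide))
      have h03 := turanGraph_two_sup_edge_adj.1 (@hf 0 3 (by decide))
      have h12 := turanGraph_two_sup_edge_adj.1 (@hf 1 2 (by decide))
      have h13 := turanGraph_two_sup_edge_adj.1 (@hf 1 3 (by decide))
      have h23 := turanGraph_two_sup_edge_adj.1 (@hf 2 3 (by decide))
      have n01 : f 0 ≠ f 1 := f.injective.ne (by decide)
      grind
    · rintro ⟨⟨hb, hb', hne⟩, hxy⟩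
      have hinj : Function.Injective ![b, b', x, y] := by
        intro i j hij
        fin_cases i <;> fin_cases j <;> simp at hij ⊢ <;> grind
      refine ⟨⟨![b, b', x, y], hinj⟩, ?_, ⟨rfl, rfl⟩, rfl, rfl⟩
      intro i j hij
      rw [hH, turanGraph_two_sup_edge_adj]
      rw [K4minusEdge_adj] at hij
      fin_cases i <;> fin_cases j <;> simp at hij ⊢ <;> grind
  have hcard : Nat.card {f : Fin 4 ↪ Fin n // ∀ ⦃a b⦄, K4minusEdge.Adj a b → H.Adj (f a) (f b)} =
      #B * (#B - 1) * 2 := by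
    have h := Nat.card_image_of_injective hφ
      {f | ∀ ⦃a b⦄, K4minusEdge.Adj a b → H.Adj (f a) (f b)}
    rw [himage, Nat.card_coe_set_eq, Set.ncard_coe_finset, card_product, offDiag_card,
      card_pair (by simp [huv]), ← Nat.mul_sub_one] at h
    exact h.symm
  rw [_root_.copyCount, hcard, card_K4minusEdge_iso, ← card_filter_mod_two_ne, ← hB, Nat.choose_two_right]
  omega

/-- For all sufficiently large `n`, `c(n, K₄ − e) = C(⌊n/2⌋, 2)`. -/
theorem critCount_K4_minus_edge :
    ∃ n₀ : ℕ, ∀ n : ℕ, n₀ < n →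
      critCount 2 n K4minusEdge = Nat.choose (n / 2) 2 := by
  refine ⟨2, fun n hn => IsLeast.csInf_eq ⟨?_, ?_⟩⟩
  · have h : (⟨0, by omega⟩ : Fin n) ≠ ⟨2, hn⟩ := by simp
    exact ⟨_, _, h, by simp, by simpa using (copyCount_K4minusEdge h (by simp)).symm⟩
  · rintro _ ⟨u, v, huv, hmod, rfl⟩
    rw [copyCount_K4minusEdge huv hmod]
    exact Nat.choose_le_choose 2 (by omega)
end

section
/- (Erdős–Simonovits Stability Theorem) Let r ≥ 2 and let F be a fixed r-critical graph. For every η > 0 there exist ξ > 0 and n_0 such that for every n > n_0: if H is a graph on n vertices with at least t_r(n) − ξ·n² edges that contains no copy of F, then there is a partition of the vertex set of H into r parts such that the number of edges of H contained entirely within a part is at most η·n². -/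
open SimpleGraph Finset

open Classical in
/-- The number of neighbours of `v` in `S`. -/
noncomputable def degOn {V : Type*} (G : SimpleGraph V) (S : Finset V) (v : V) : ℕ :=
  #{w ∈ S | G.Adj v w}

/-- The number of ordered pairs of adjacent vertices in `S`. -/
noncomputable def dartsOn {V : Type*} (G : SimpleGraph V) (S : Finset V) : ℕ :=
  ∑ v ∈ S, degOn G S v

/-- `A` is a family of `t`-sets of vertices with all edges of `G` between distinct members. -/
def IsBlowup {V ι : Type*} (G : SimpleGraph V) (t : ℕ) (A : ι → Finset V) : Prop :=
  (∀ i, #(A i) = t) ∧ ∀ i j, i ≠ j → ∀ x ∈ A i, ∀ y ∈ A j, G.Adj x y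

section Blowup

variable {V : Type*} {G : SimpleGraph V}

lemma degOn_le_card (S : Finset V) (v : V) : degOn G S v ≤ #S := by
  classical
  exact card_filter_le _ _

lemma degOn_mono {S T : Finset V} (h : S ⊆ T) (v : V) : degOn G S v ≤ degOn G T v := by
  classical
  exact card_le_card (filter_subset_filter _ h)

lemma dartsOn_le_sq (S : Finset V) : dartsOn G S ≤ #S ^ 2 := by
  rw [sq, ← smul_eq_mul]
  exact sum_le_card_nsmul _ _ _ fun v _ ↦ degOn_le_card S v

lemma sum_degOn_comm (S T : Finset V) : ∑ v ∈ S, degOn G T v = ∑ w ∈ T, degOn G S w := by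
  classical
  simp_rw [degOn, card_filter]
  rw [sum_comm]
  simp_rw [G.adj_comm]

lemma dartsOn_erase [DecidableEq V] {S : Finset V} {v : V} (hv : v ∈ S) :
    dartsOn G (S.erase v) + 2 * degOn G S v = dartsOn G S := by
  classical
  have hd (u : V) : degOn G S u = degOn G (S.erase v) u + if G.Adj u v then 1 else 0 := by
    simp_rw [degOn, card_filter]
    rw [sum_erase_add _ _ hv]
  have hs : ∑ u ∈ S.erase v, (if G.Adj u v then 1 else 0) = degOn G (S.erase v) v := by
    simp_rw [degOn, card_filter, G.adj_comm]
  have hv' : degOn G S v = degOn G (S.erase v) v := by simp [hd v]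
  rw [dartsOn, dartsOn, ← sum_erase_add _ _ hv, sum_congr rfl fun u _ ↦ hd u, sum_add_distrib, hs,
    hv']
  ring

lemma exists_subset_forall_le_degOn (G : SimpleGraph V) (S₀ : Finset V) (c : ℝ) :
    ∃ S ⊆ S₀, (∀ v ∈ S, c * #S ≤ degOn G S v) ∧
      dartsOn G S₀ - c * (#S₀ * (#S₀ + 1)) ≤ dartsOn G S - c * (#S * (#S + 1)) := by
  classical
  obtain ⟨S, hS, hmax⟩ := exists_max_image S₀.powerset
    (fun S ↦ (dartsOn G S : ℝ) - c * (#S * (#S + 1))) ⟨S₀, by simp⟩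
  rw [mem_powerset] at hS
  refine ⟨S, hS, fun v hv ↦ ?_, hmax S₀ (by simp)⟩
  have h := hmax (S.erase v) (by simpa using (erase_subset v S).trans hS)
  have hcard : ((#(S.erase v) : ℕ) : ℝ) = #S - 1 := by
    rw [← card_erase_add_one hv]
    simp
  have he : (dartsOn G (S.erase v) : ℝ) + 2 * degOn G S v = dartsOn G S :=
    mod_cast dartsOn_erase hv
  rw [hcard] at h
  linarith

lemma exists_isBlowup_of_le_degOn {ε : ℝ} (hε : 0 < ε) (r t : ℕ) :
    ∃ N : ℕ, ∀ {V : Type*} (G : SimpleGraph V) (S : Finset V), N ≤ #S →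
      (∀ v ∈ S, (1 - 1 / r + ε) * #S ≤ degOn G S v) →
      ∃ A : Fin (r + 1) → Finset V, (∀ i, A i ⊆ S) ∧ IsBlowup G t A := by
  classical
  obtain ⟨N, hN⟩ := Filter.eventually_atTop.mp
    (eventually_completeEquipartiteGraph_isContained_of_minDegree hε r t)
  refine ⟨N + 1, fun {V} G S hS hdeg ↦ ?_⟩
  let e : Fin #S ↪ V := S.equivFin.symm.toEmbedding.trans (Function.Embedding.subtype _)
  have heS (i) : e i ∈ S := (S.equivFin.symm i).2
  have hmap : univ.map e = S := by
    ext v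
    simp only [mem_map, mem_univ, true_and]
    exact ⟨fun ⟨i, hi⟩ ↦ hi ▸ heS i, fun hv ↦ ⟨S.equivFin ⟨v, hv⟩, by simp [e]⟩⟩
  have hdeg' (i) : (G.comap e).degree i = degOn G S (e i) := by
    rw [← card_neighborFinset_eq_degree, neighborFinset_eq_filter, degOn]
    have : {w ∈ S | G.Adj (e i) w} = {w ∈ univ.map e | G.Adj (e i) w} := by rw [hmap]
    rw [this, filter_map, card_map]
    rfl
  have : Nonempty (Fin #S) := ⟨⟨0, by lia⟩⟩
  obtain ⟨f⟩ := hN #S (by lia) (G := G.comap e) (by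
    obtain ⟨i, hi⟩ := (G.comap e).exists_minimal_degree_vertex
    rw [hi, hdeg']
    exact hdeg _ (heS i))
  refine ⟨fun i ↦ univ.map ⟨fun j ↦ e (f (i, j)), fun a b h ↦ ?_⟩, fun i x hx ↦ ?_, fun i ↦ ?_,
    fun i j hij x hx y hy ↦ ?_⟩
  · simpa using f.injective (e.injective h)
  · simp only [mem_map, mem_univ, true_and] at hx
    obtain ⟨j, rfl⟩ := hx
    exact heS _
  · simp
  · simp only [mem_map, mem_univ, true_and] at hx hy
    obtain ⟨a, rfl⟩ := hx
    obtain ⟨b, rfl⟩ := hy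
    exact f.toHom.map_adj (show (completeEquipartiteGraph (r + 1) t).Adj (i, a) (j, b) from hij)

lemma exists_isBlowup_of_lt_dartsOn {ε : ℝ} (hε : 0 < ε) {r : ℕ} (hr : 0 < r) (t : ℕ) :
    ∃ C : ℝ, ∀ {V : Type*} (G : SimpleGraph V) (S : Finset V),
      (1 - 1 / r + ε) * #S ^ 2 + C < dartsOn G S →
      ∃ A : Fin (r + 1) → Finset V, (∀ i, A i ⊆ S) ∧ IsBlowup G t A := by
  obtain ⟨N, hN⟩ := exists_isBlowup_of_le_degOn (half_pos hε) r t
  have hr' : (1 : ℝ) / r ≤ 1 := by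
    rw [div_le_one (by positivity)]
    exact mod_cast hr
  set c : ℝ := 1 - 1 / r + ε / 2 with hc
  have hc0 : 0 ≤ c := by linarith
  refine ⟨N ^ 2 + c ^ 2 / (2 * ε), fun {V} G S hlt ↦ ?_⟩
  obtain ⟨S', hS', hdeg, hdarts⟩ := exists_subset_forall_le_degOn G S c
  obtain hlarge | hsmall := le_or_gt N #S'
  · obtain ⟨A, hA, hA'⟩ := hN G S' hlarge hdeg
    exact ⟨A, fun i ↦ (hA i).trans hS', hA'⟩
  · exfalso
    have h1 : (dartsOn G S' : ℝ) ≤ #S' ^ 2 := mod_cast dartsOn_le_sq S'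
    have h2 : (#S' : ℝ) ^ 2 ≤ N ^ 2 := by gcongr
    have h3 : 0 ≤ c * (#S' * (#S' + 1)) := by positivity
    have h4 : c * #S ≤ ε / 2 * #S ^ 2 + c ^ 2 / (2 * ε) := by
      have : ε / 2 * #S ^ 2 + c ^ 2 / (2 * ε) - c * #S = (ε * #S - c) ^ 2 / (2 * ε) := by
        field_simp
        ring
      have : 0 ≤ (ε * #S - c) ^ 2 / (2 * ε) := by positivity
      linarith
    have h5 : (1 - 1 / r + ε) * (#S : ℝ) ^ 2 = c * #S ^ 2 + ε / 2 * #S ^ 2 := by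
      rw [hc]
      ring
    linarith

lemma le_of_sub_sq_mul_le {δ n s C : ℝ} (hδ : 0 < δ) (hδ' : δ ≤ 1 / 4) (hs : 0 ≤ s)
    (hC : n + C < δ ^ 2 * n ^ 2) (h : (δ - δ ^ 2) * n ^ 2 - n - C ≤ (δ + δ ^ 2) * s ^ 2) :
    (1 - 2 * δ) * n ≤ s := by
  by_contra! hlt
  have h1 : s ^ 2 ≤ ((1 - 2 * δ) * n) ^ 2 := by gcongr
  have h2 : (δ + δ ^ 2) * s ^ 2 ≤ (δ + δ ^ 2) * ((1 - 2 * δ) * n) ^ 2 := by gcongr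
  have h3 : 0 ≤ δ ^ 2 * (1 - 4 * δ ^ 2) * n ^ 2 := by
    have : 0 ≤ 1 - 4 * δ ^ 2 := by nlinarith
    positivity
  linarith

lemma exists_isBlowup_of_sub_le_dartsOn {r : ℕ} (hr : 2 ≤ r) (t T : ℕ) {δ : ℝ} (hδ : 0 < δ) :
    ∃ ξ : ℝ, 0 < ξ ∧ ∃ n₀ : ℕ, ∀ {V : Type*} [Fintype V] (G : SimpleGraph V),
      n₀ ≤ Fintype.card V →
      (1 - 1 / r - ξ) * (Fintype.card V : ℝ) ^ 2 ≤ dartsOn G univ →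
      (¬ ∃ A : Fin (r + 1) → Finset V, IsBlowup G t A) →
      ∃ A : Fin r → Finset V, IsBlowup G T A ∧
        ∀ i, ∀ x ∈ A i, (1 - 1 / r - δ) * (Fintype.card V : ℝ) ≤ degOn G univ x := by
  obtain ⟨k, rfl⟩ : ∃ k, r = k + 1 := ⟨r - 1, by lia⟩
  have hk : (1 : ℝ) ≤ k := mod_cast (by lia : 1 ≤ k)
  set ε₀ : ℝ := 1 / (2 * (k * (k + 1))) with hε₀
  have hε₀pos : 0 < ε₀ := by positivity
  have hε₀le : ε₀ ≤ 1 / 4 := by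
    rw [hε₀]
    gcongr
    nlinarith
  have hgap : (1 : ℝ) / k - 1 / (k + 1) = 2 * ε₀ := by
    rw [hε₀]
    field_simp
    ring
  obtain ⟨δ', hδ', hδδ, hδε⟩ : ∃ δ' : ℝ, 0 < δ' ∧ 3 * δ' ≤ δ ∧ δ' ≤ ε₀ :=
    ⟨min (δ / 3) ε₀, by positivity, by linarith [min_le_left (δ / 3) ε₀], min_le_right _ _⟩
  obtain ⟨C, hC⟩ := exists_isBlowup_of_lt_dartsOn (ε := δ' ^ 2) (by positivity) k.succ_pos t
  obtain ⟨N, hN⟩ := exists_isBlowup_of_le_degOn hε₀pos k T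
  obtain ⟨n₀, hn₀⟩ := Filter.eventually_atTop.mp (Filter.Tendsto.eventually_ge_atTop
    (tendsto_natCast_atTop_atTop (R := ℝ)) (max (2 * N) ((1 + |C|) / δ' ^ 2 + 1)))
  refine ⟨δ' ^ 2, by positivity, n₀, fun {V} _ G hcard hdarts hfree ↦ ?_⟩
  set n : ℝ := (Fintype.card V : ℝ) with hn
  have hnN : 2 * N ≤ n := (le_max_left _ _).trans (hn₀ _ hcard)
  have hnC : (1 + |C|) / δ' ^ 2 + 1 ≤ n := (le_max_right _ _).trans (hn₀ _ hcard)
  have hn1 : 1 ≤ n := hnC.trans' (by linarith [show 0 ≤ (1 + |C|) / δ' ^ 2 by positivity])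
  have hnC' : n + C < δ' ^ 2 * n ^ 2 := by
    have h1 : 1 + |C| < δ' ^ 2 * n := by
      rw [← div_lt_iff₀' (by positivity)]
      linarith
    nlinarith [le_abs_self C, abs_nonneg C]
  set q : ℝ := 1 - 1 / ((k + 1 : ℕ) : ℝ) with hq
  have hq' : q = 1 - 1 / k + 2 * ε₀ := by
    rw [hq, ← hgap]
    push_cast
    ring
  have hq1 : q ≤ 1 := by
    rw [hq]
    linarith [show (0 : ℝ) ≤ 1 / ((k + 1 : ℕ) : ℝ) by positivity]
  have hq2 : 2 * ε₀ ≤ q := by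
    have : (1 : ℝ) / k ≤ 1 := by rwa [div_le_one (by positivity)]
    linarith
  obtain ⟨S, -, hdeg, hSdarts⟩ := exists_subset_forall_le_degOn G univ (q - δ')
  have hSC : (dartsOn G S : ℝ) ≤ (q + δ' ^ 2) * #S ^ 2 + C := by
    by_contra! hlt
    obtain ⟨A, -, hA⟩ := hC G S hlt
    exact hfree ⟨A, hA⟩
  rw [card_univ, ← hn] at hSdarts
  set s : ℝ := (#S : ℝ) with hs
  have hs0 : 0 ≤ s := by positivity
  have hkey : (δ' - δ' ^ 2) * n ^ 2 - n - C ≤ (δ' + δ' ^ 2) * s ^ 2 := by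
    have h1 : 0 ≤ (q - δ') * s := mul_nonneg (by linarith) hs0
    have h2 : (q - δ') * n ≤ 1 * n := by
      gcongr
      linarith
    linarith
  have hsn : (1 - 2 * δ') * n ≤ s :=
    le_of_sub_sq_mul_le hδ' (by linarith) hs0 hnC' hkey
  have hNS : N ≤ #S := by
    have : 1 / 2 * n ≤ (1 - 2 * δ') * n := by
      gcongr
      linarith
    have : (N : ℝ) ≤ #S := by linarith
    exact mod_cast this
  obtain ⟨A, hAS, hA⟩ := hN G S hNS fun v hv ↦ (hdeg v hv).trans' (by
    rw [← hs]
    gcongr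
    linarith)
  refine ⟨A, hA, fun i x hx ↦ ?_⟩
  have h1 : (degOn G S x : ℝ) ≤ degOn G univ x := mod_cast degOn_mono (subset_univ S) x
  have h2 := hdeg x (hAS i hx)
  have h3 : (q - δ') * ((1 - 2 * δ') * n) ≤ (q - δ') * s :=
    mul_le_mul_of_nonneg_left hsn (by linarith)
  have h4 : (q - δ) * n ≤ (q - δ') * ((1 - 2 * δ') * n) := by
    rw [← mul_assoc]
    gcongr
    nlinarith
  linarith

lemma IsBlowup.card_forall_le_degOn_le [Fintype V] {r t T : ℕ} {A : Fin r → Finset V}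
    (hA : IsBlowup G T A) (hfree : ¬ ∃ B : Fin (r + 1) → Finset V, IsBlowup G t B) :
    #{v | ∀ i, t ≤ degOn G (A i) v} ≤ 2 ^ (r * T) * t := by
  classical
  by_contra! hlt
  set U : Finset V := univ.biUnion A with hU
  have hUcard : #U ≤ r * T := by
    refine card_biUnion_le.trans ?_
    simp [hA.1]
  obtain ⟨Y, -, hY⟩ := exists_lt_card_fiber_of_mul_lt_card_of_maps_to
    (s := {v | ∀ i, t ≤ degOn G (A i) v}) (t := U.powerset) (n := t)
    (f := fun v ↦ U.filter (G.Adj v)) (fun v _ ↦ by simp) (by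
      refine hlt.trans_le' ?_
      rw [card_powerset]
      gcongr
      norm_num)
  set W := {x ∈ ({v | ∀ i, t ≤ degOn G (A i) v} : Finset V) | U.filter (G.Adj x) = Y} with hW
  obtain ⟨W', hW'W, hW'⟩ := exists_subset_card_eq hY.le
  obtain ⟨w, hw⟩ := card_pos.mp (by lia : 0 < #W)
  rw [hW, mem_filter, mem_filter] at hw
  choose B hBsub hBcard using fun i ↦ exists_subset_card_eq (hw.1.2 i)
  have hWB : ∀ x ∈ W', ∀ i, ∀ y ∈ B i, G.Adj x y := by
    intro x hx i y hy
    have hx' := (mem_filter.mp (hW'W hx)).2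
    have hy' := mem_filter.mp (hBsub i hy)
    have : y ∈ U.filter (G.Adj w) := mem_filter.mpr ⟨mem_biUnion.mpr ⟨i, mem_univ _, hy'.1⟩, hy'.2⟩
    rw [hw.2, ← hx'] at this
    exact (mem_filter.mp this).2
  refine hfree ⟨Fin.cons W' B, fun i ↦ ?_, fun i j hij x hx y hy ↦ ?_⟩
  · cases i using Fin.cases <;> simp [hW', hBcard]
  · cases i using Fin.cases with
    | zero => cases j using Fin.cases with
      | zero => exact absurd rfl hij
      | succ j => exact hWB x (by simpa using hx) j y (by simpa using hy)
    | succ i => cases j using Fin.cases with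
      | zero => exact (hWB y (by simpa using hy) i x (by simpa using hx)).symm
      | succ j =>
        exact hA.2 i j (by simpa using hij) x (mem_of_mem_filter x (hBsub i (by simpa using hx)))
          y (mem_of_mem_filter y (hBsub j (by simpa using hy)))

/-- Replacing the `i`-th member of a blowup by two mutually complete sets that see almost all of
the other members gives a blowup with one more member. -/
lemma IsBlowup.exists_isBlowup_succ {r t T : ℕ} {A : Fin r → Finset V}
    (hA : IsBlowup G T A) (hT : 2 * t ≤ T) (i : Fin r) {B : Fin 2 → Finset V}
    (hB : IsBlowup G t B)
    (hdeg : ∀ j ≠ i, ∀ k, ∀ x ∈ B k, 4 * t * T ≤ 4 * t * degOn G (A j) x + T) :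
    ∃ D : Fin (r + 1) → Finset V, IsBlowup G t D := by
  classical
  obtain rfl | ht := t.eq_zero_or_pos
  · exact ⟨fun _ ↦ ∅, by simp [IsBlowup]⟩
  set W : Finset V := B 0 ∪ B 1 with hW
  have hWcard : #W ≤ 2 * t := (card_union_le _ _).trans (by simp [hB.1]; lia)
  have hmemW {x} (hx : x ∈ W) : ∃ k, x ∈ B k := by
    rw [hW, mem_union] at hx
    exact hx.elim (⟨0, ·⟩) (⟨1, ·⟩)
  have hcommon : ∀ j ≠ i, t ≤ #{y ∈ A j | ∀ x ∈ W, G.Adj x y} := by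
    intro j hj
    have hbad : #{y ∈ A j | ¬ ∀ x ∈ W, G.Adj x y} ≤ ∑ x ∈ W, #{y ∈ A j | ¬ G.Adj x y} := by
      refine (card_le_card fun y hy ↦ ?_).trans card_biUnion_le
      simp only [mem_filter, not_forall, mem_biUnion] at hy ⊢
      obtain ⟨hy, x, hx, hxy⟩ := hy
      exact ⟨x, hx, hy, hxy⟩
    have hx : ∀ x ∈ W, 4 * t * #{y ∈ A j | ¬ G.Adj x y} ≤ T := by
      intro x hx
      obtain ⟨k, hk⟩ := hmemW hx
      have h1 := hdeg j hj k x hk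
      have h2 : degOn G (A j) x + #{y ∈ A j | ¬ G.Adj x y} = T := by
        rw [← hA.1 j]
        exact card_filter_add_card_filter_not _
      nlinarith
    have h3 : 4 * t * #{y ∈ A j | ¬ ∀ x ∈ W, G.Adj x y} ≤ 2 * t * T := by
      calc _ ≤ 4 * t * ∑ x ∈ W, #{y ∈ A j | ¬ G.Adj x y} := by gcongr
        _ = ∑ x ∈ W, 4 * t * #{y ∈ A j | ¬ G.Adj x y} := mul_sum ..
        _ ≤ #W * T := by
          rw [← smul_eq_mul]
          exact sum_le_card_nsmul _ _ _ hx
        _ ≤ 2 * t * T := by gcongr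
    have h4 : 2 * #{y ∈ A j | ¬ ∀ x ∈ W, G.Adj x y} ≤ T :=
      Nat.le_of_mul_le_mul_left (by linarith) (by lia : 0 < 2 * t)
    have h5 : #{y ∈ A j | ∀ x ∈ W, G.Adj x y} + #{y ∈ A j | ¬ ∀ x ∈ W, G.Adj x y} = T := by
      rw [← hA.1 j]
      exact card_filter_add_card_filter_not _
    lia
  have hsets : ∀ j, ∃ D : Finset V, #D = t ∧ (j = i → D = B 1) ∧
      (j ≠ i → D ⊆ {y ∈ A j | ∀ x ∈ W, G.Adj x y}) := by
    intro j
    obtain rfl | hj := eq_or_ne j i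
    · exact ⟨B 1, hB.1 1, fun _ ↦ rfl, fun h ↦ absurd rfl h⟩
    · obtain ⟨D, hD, hD'⟩ := exists_subset_card_eq (hcommon j hj)
      exact ⟨D, hD', fun h ↦ absurd h hj, fun _ ↦ hD⟩
  choose D hDcard hDi hDj using hsets
  have hWD : ∀ x ∈ W, ∀ j ≠ i, ∀ y ∈ D j, G.Adj x y :=
    fun x hx j hj y hy ↦ (mem_filter.mp (hDj j hj hy)).2 x hx
  have h0 : ∀ x ∈ B 0, ∀ j, ∀ y ∈ D j, G.Adj x y := by
    intro x hx j y hy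
    obtain rfl | hj := eq_or_ne j i
    · rw [hDi _ rfl] at hy
      exact hB.2 0 1 (by decide) x hx y hy
    · exact hWD x (mem_union_left _ hx) j hj y hy
  refine ⟨Fin.cons (B 0) D, fun j ↦ ?_, fun j k hjk x hx y hy ↦ ?_⟩
  · cases j using Fin.cases <;> simp [hB.1, hDcard]
  · cases j using Fin.cases with
    | zero => cases k using Fin.cases with
      | zero => exact absurd rfl hjk
      | succ k => exact h0 x (by simpa using hx) k y (by simpa using hy)
    | succ j =>
      simp only [Fin.cons_succ] at hx
      cases k using Fin.cases with
      | zero => exact (h0 y (by simpa using hy) j x hx).symm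
      | succ k =>
        simp only [Fin.cons_succ] at hy
        have hjk' : j ≠ k := by simpa using hjk
        obtain rfl | hj := eq_or_ne j i
        · rw [hDi _ rfl] at hx
          exact hWD x (mem_union_right _ hx) k hjk'.symm y hy
        · obtain rfl | hk := eq_or_ne k i
          · rw [hDi _ rfl] at hy
            exact (hWD y (mem_union_right _ hy) j hjk' x hx).symm
          · exact hA.2 j k hjk' x (mem_of_mem_filter x (hDj j hj hx))
              y (mem_of_mem_filter y (hDj k hk hy))

open Classical in
lemma sum_card_adj_eq_le [Fintype V] {ι : Type*} [Fintype ι] (P : V → ι) (X : Finset V) :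
    ∑ v, #{w | G.Adj v w ∧ P v = P w} ≤
      2 * #X * Fintype.card V + ∑ i, dartsOn G {v | v ∉ X ∧ P v = i} := by
  have hpoint (v : V) : #{w | G.Adj v w ∧ P v = P w} ≤
      (if v ∈ X then Fintype.card V else 0) + #X +
        if v ∉ X then degOn G {w | w ∉ X ∧ P w = P v} v else 0 := by
    by_cases hv : v ∈ X
    · simp only [hv, if_true, not_true_eq_false, if_false]
      have := card_le_univ ({w | G.Adj v w ∧ P v = P w} : Finset V)
      lia
    · simp only [hv, if_false, not_false_eq_true, if_true, zero_add, degOn]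
      refine (card_le_card fun w hw ↦ ?_).trans (card_union_le _ _)
      simp only [mem_filter, mem_univ, true_and, mem_union] at hw ⊢
      by_cases hwX : w ∈ X
      · exact .inl hwX
      · exact .inr ⟨⟨hwX, hw.2.symm⟩, hw.1⟩
  refine (sum_le_sum fun v _ ↦ hpoint v).trans ?_
  have hfib : ∑ i, dartsOn G {v | v ∉ X ∧ P v = i} =
      ∑ v, if v ∉ X then degOn G {w | w ∉ X ∧ P w = P v} v else 0 := by
    rw [← sum_filter, ← sum_fiberwise _ P]
    refine sum_congr rfl fun i _ ↦ ?_
    rw [dartsOn, filter_filter]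
    refine sum_congr rfl fun v hv ↦ ?_
    rw [← (mem_filter.mp hv).2.2]
  rw [sum_add_distrib, sum_add_distrib, hfib, ← sum_filter]
  simp only [sum_const, card_univ, smul_eq_mul, filter_mem_eq_inter, univ_inter]
  linarith [mul_comm (#X) (Fintype.card V)]

lemma IsBlowup.card_le_of_degOn_lt [Fintype V] {r t T : ℕ} {A : Fin r → Finset V}
    (hA : IsBlowup G T A) (hr : 0 < r) (hT : 0 < T) {δ : ℝ}
    (hdeg : ∀ i, ∀ x ∈ A i, (1 - 1 / r - δ) * (Fintype.card V : ℝ) ≤ degOn G univ x)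
    (P : V → Fin r) {E B : Finset V} (hE : ∀ v ∉ E, degOn G (A (P v)) v ≤ t)
    (hBE : Disjoint B E)
    (hB : ∀ v ∈ B, ∃ j ≠ P v, 4 * t * degOn G (A j) v + T ≤ 4 * t * T) :
    (#B : ℝ) ≤ (4 * t ^ 2 / T + 4 * t * r * δ) * Fintype.card V + 4 * t * r * #E := by
  classical
  have hT' : (0 : ℝ) < T := mod_cast hT
  have hr' : (0 : ℝ) < r := mod_cast hr
  have hle (i v) : (degOn G (A i) v : ℝ) ≤ T := by
    have := degOn_le_card (G := G) (A i) v
    rw [hA.1] at this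
    exact mod_cast this
  have hdef (v) : ∑ i, ((T : ℝ) - degOn G (A i) v) = r * T - ∑ i, (degOn G (A i) v : ℝ) := by
    simp
  have hpoint (v : V) : 4 * t * ∑ i, (degOn G (A i) v : ℝ) + (if v ∈ B then (T : ℝ) else 0) ≤
      4 * t * (t + (r - 1) * T) + if v ∈ E then 4 * t * (r * T : ℝ) else 0 := by
    have hnonneg : ∀ i ∈ univ, (0 : ℝ) ≤ T - degOn G (A i) v := fun i _ ↦ sub_nonneg.mpr (hle i v)
    by_cases hvE : v ∈ E
    · have hvB : v ∉ B := fun h ↦ disjoint_left.mp hBE h hvE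
      simp only [hvE, hvB, if_true, if_false, add_zero]
      have h1 := sum_nonneg hnonneg
      rw [hdef] at h1
      have h2 : 4 * t * ∑ i, (degOn G (A i) v : ℝ) ≤ 4 * t * (r * T) := by
        gcongr
        linarith
      have h3 : (0 : ℝ) ≤ 4 * t * (t + (r - 1) * T) := by
        have : (1 : ℝ) ≤ r := mod_cast hr
        have : (0 : ℝ) ≤ r - 1 := by linarith
        positivity
      linarith
    · have hP : (degOn G (A (P v)) v : ℝ) ≤ t := mod_cast hE v hvE
      simp only [hvE, if_false, add_zero]
      by_cases hvB : v ∈ B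
      · simp only [hvB, if_true]
        obtain ⟨j, hj, hjT⟩ := hB v hvB
        have h1 := sum_le_sum_of_subset_of_nonneg (subset_univ {P v, j}) fun i hi _ ↦ hnonneg i hi
        rw [hdef, sum_pair hj.symm] at h1
        have h2 : 4 * t * (degOn G (A j) v : ℝ) + T ≤ 4 * t * T := mod_cast hjT
        have h3 : (4 * t : ℝ) * (∑ i, (degOn G (A i) v : ℝ)) ≤
            4 * t * (t + (r - 2) * T + degOn G (A j) v) := by
          gcongr
          linarith
        linarith
      · simp only [hvB, if_false, add_zero]
        have h1 := single_le_sum hnonneg (mem_univ (P v))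
        rw [hdef] at h1
        gcongr
        linarith
  have hsum := sum_le_sum fun v (_ : v ∈ univ) ↦ hpoint v
  rw [sum_add_distrib, sum_add_distrib, ← mul_sum, ← sum_filter, ← sum_filter] at hsum
  simp only [sum_const, card_univ, nsmul_eq_mul, filter_mem_eq_inter, univ_inter] at hsum
  have hlow : (r : ℝ) * (T * ((1 - 1 / r - δ) * Fintype.card V)) ≤
      ∑ v, ∑ i, (degOn G (A i) v : ℝ) := by
    rw [sum_comm]
    have hi (i : Fin r) : (T * ((1 - 1 / r - δ) * Fintype.card V) : ℝ) ≤
        ∑ v, (degOn G (A i) v : ℝ) := by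
      have := sum_degOn_comm (G := G) univ (A i)
      rw [← Nat.cast_sum, this, Nat.cast_sum, ← hA.1 i, ← nsmul_eq_mul]
      exact card_nsmul_le_sum _ _ _ (hdeg i)
    have := card_nsmul_le_sum univ _ _ fun i _ ↦ hi i
    simpa using this
  have hlow' : (r : ℝ) * (T * ((1 - 1 / r - δ) * Fintype.card V)) =
      T * (r - 1 - r * δ) * Fintype.card V := by
    field_simp
  rw [hlow'] at hlow
  have hlow'' := mul_le_mul_of_nonneg_left hlow (by positivity : (0 : ℝ) ≤ 4 * t)
  refine le_of_mul_le_mul_right ?_ hT'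
  have : ((4 * t ^ 2 / T + 4 * t * r * δ) * Fintype.card V + 4 * t * r * #E) * (T : ℝ) =
      (4 * t ^ 2 + 4 * t * r * δ * T) * Fintype.card V + 4 * t * r * #E * T := by
    field_simp
  rw [this]
  linarith

open Classical in
lemma exists_forall_sum_card_adj_eq_le {r t : ℕ} (hr : 2 ≤ r) (ht : 0 < t) {η : ℝ} (hη : 0 < η) :
    ∃ ξ : ℝ, 0 < ξ ∧ ∃ n₀ : ℕ, ∀ {V : Type*} [Fintype V] (G : SimpleGraph V),
      n₀ ≤ Fintype.card V →
      (1 - 1 / r - ξ) * (Fintype.card V : ℝ) ^ 2 ≤ dartsOn G univ →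
      (¬ ∃ A : Fin (r + 1) → Finset V, IsBlowup G t A) →
      ∃ P : V → Fin r,
        ((∑ v, #{w | G.Adj v w ∧ P v = P w} : ℕ) : ℝ) ≤ η * (Fintype.card V : ℝ) ^ 2 := by
  have hr' : (0 : ℝ) < r := mod_cast (by lia : 0 < r)
  have ht' : (0 : ℝ) < t := mod_cast ht
  obtain ⟨C, hC⟩ := exists_isBlowup_of_lt_dartsOn (ε := η / (4 * r)) (by positivity) one_pos t
  obtain ⟨T, hT⟩ := exists_nat_ge (max (2 * t : ℝ) (64 * t ^ 2 / η))
  have hTt : 2 * t ≤ T := by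
    have : (2 * t : ℝ) ≤ T := (le_max_left _ _).trans hT
    exact mod_cast this
  have hT0 : (0 : ℝ) < T := mod_cast (by lia : 0 < T)
  have hTη : 4 * t ^ 2 / T ≤ η / 16 := by
    have := (le_max_right _ _).trans hT
    rw [div_le_iff₀ hη] at this
    rw [div_le_iff₀ hT0]
    linarith
  obtain ⟨ξ, hξ, n₁, hn₁⟩ := exists_isBlowup_of_sub_le_dartsOn hr t T
    (δ := η / (64 * t * r)) (by positivity)
  set M : ℝ := 2 ^ (r * T) * t with hM
  obtain ⟨n₂, hn₂⟩ := Filter.eventually_atTop.mp (Filter.Tendsto.eventually_ge_atTop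
    (tendsto_natCast_atTop_atTop (R := ℝ)) (max 1 (max ((1 + 4 * t * r) * M / (η / 8))
      (r * |C| / (η / 4)))))
  refine ⟨ξ, hξ, max n₁ n₂, fun {V} _ G hcard hdarts hfree ↦ ?_⟩
  obtain ⟨A, hA, hAdeg⟩ := hn₁ G ((le_max_left _ _).trans hcard) hdarts hfree
  have hn := hn₂ _ ((le_max_right _ _).trans hcard)
  set n : ℝ := (Fintype.card V : ℝ) with hn_def
  have hn1 : 1 ≤ n := (le_max_left _ _).trans hn
  have hnM : (1 + 4 * t * r) * M ≤ η / 8 * n := by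
    rw [← div_le_iff₀' (by positivity)]
    exact ((le_max_left _ _).trans (le_max_right _ _)).trans hn
  have hnC : r * C ≤ η / 4 * n ^ 2 := by
    have h1 : r * |C| ≤ η / 4 * n := by
      rw [← div_le_iff₀' (by positivity)]
      exact ((le_max_right _ _).trans (le_max_right _ _)).trans hn
    have h2 : r * C ≤ r * |C| := by
      gcongr
      exact le_abs_self C
    have h3 : η / 4 * n ≤ η / 4 * n ^ 2 := by
      gcongr
      exact le_self_pow₀ hn1 two_ne_zero
    linarith
  have : Nonempty (Fin r) := ⟨⟨0, by lia⟩⟩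
  choose P hP using fun v ↦ Finite.exists_min fun i ↦ degOn G (A i) v
  set E : Finset V := {v | ∀ i, t ≤ degOn G (A i) v} with hE
  set B : Finset V := {v | v ∉ E ∧ ∃ j ≠ P v, 4 * t * degOn G (A j) v + T ≤ 4 * t * T} with hB
  have hEcard : (#E : ℝ) ≤ M := by
    rw [hM]
    exact mod_cast hA.card_forall_le_degOn_le hfree
  have hBcard := hA.card_le_of_degOn_lt (t := t) (by lia) (by lia) hAdeg P (E := E) (B := B)
    (fun v hv ↦ by
      simp only [hE, mem_filter, mem_univ, true_and, not_forall, not_le] at hv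
      obtain ⟨i, hi⟩ := hv
      exact (hP v i).trans hi.le)
    (disjoint_left.mpr fun v hv ↦ (mem_filter.mp hv).2.1)
    fun v hv ↦ (mem_filter.mp hv).2.2
  have hXcard : (#(E ∪ B) : ℝ) ≤ η / 4 * n := by
    have h1 : (#(E ∪ B) : ℝ) ≤ #E + #B := mod_cast card_union_le E B
    have h2 : (4 * t * r * (η / (64 * t * r)) : ℝ) = η / 16 := by
      field_simp
      norm_num
    have h3 : (4 * t ^ 2 / T + 4 * t * r * (η / (64 * t * r))) * n ≤ η / 8 * n := by
      gcongr
      linarith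
    have h4 : (1 + 4 * t * r) * (#E : ℝ) ≤ (1 + 4 * t * r) * M := by gcongr
    linarith
  have hgood (i : Fin r) :
      (dartsOn G {v | v ∉ E ∪ B ∧ P v = i} : ℝ) ≤ η / (4 * r) * n ^ 2 + C := by
    by_contra! hlt
    obtain ⟨D, hDsub, hD⟩ := hC G {v | v ∉ E ∪ B ∧ P v = i} (hlt.trans_le' (by
      simp only [Nat.cast_one, div_one, sub_self, zero_add]
      gcongr
      rw [hn_def]
      exact Nat.cast_le.mpr (card_le_univ _)))
    refine hfree (hA.exists_isBlowup_succ hTt i hD fun j hj k x hx ↦ ?_)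
    have hx' := (mem_filter.mp (hDsub k hx)).2
    obtain ⟨hxX, rfl⟩ := hx'
    rw [mem_union, not_or] at hxX
    by_contra! hlt'
    exact hxX.2 (mem_filter.mpr ⟨mem_univ _, hxX.1, j, hj, hlt'.le⟩)
  refine ⟨P, ?_⟩
  have hfinal : ((∑ v, #{w | G.Adj v w ∧ P v = P w} : ℕ) : ℝ) ≤
      2 * #(E ∪ B) * n + ∑ i, (dartsOn G {v | v ∉ E ∪ B ∧ P v = i} : ℝ) := by
    rw [hn_def]
    norm_cast
    convert sum_card_adj_eq_le (G := G) P (E ∪ B)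
  have hsum := sum_le_sum fun i (_ : i ∈ univ) ↦ hgood i
  rw [sum_const, card_univ, Fintype.card_fin, nsmul_eq_mul] at hsum
  have h1 : r * (η / (4 * r) * n ^ 2 + C) = η / 4 * n ^ 2 + r * C := by
    field_simp
  have h2 : 2 * #(E ∪ B) * n ≤ 2 * (η / 4 * n) * n := by gcongr
  linarith

end Blowup

lemma IsBlowup.hasCopy {α V : Type*} [Fintype α] {F : SimpleGraph α} {G : SimpleGraph V}
    {k t : ℕ} (hF : F.Colorable k) (ht : Fintype.card α ≤ t) {A : Fin k → Finset V}
    (hA : IsBlowup G t A) : HasCopy F G := by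
  obtain ⟨c⟩ := hF
  have hemb (i : Fin k) : Nonempty (α ↪ A i) := by
    rw [Function.Embedding.nonempty_iff_card_le, Fintype.card_coe, hA.1]
    exact ht
  have e (i : Fin k) : α ↪ A i := (hemb i).some
  refine ⟨⟨fun v ↦ e (c v) v, fun v w h ↦ ?_⟩, fun v w h ↦ ?_⟩
  · by_cases hvw : c v = c w
    · replace h : (e (c v) v : V) = e (c w) w := h
      rw [hvw] at h
      exact (e (c w)).injective (Subtype.ext h)
    · have := hA.2 _ _ hvw _ (e (c v) v).2 _ (e (c w) w).2
      exact absurd h this.ne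
  · exact hA.2 _ _ (c.valid h) _ (e (c v) v).2 _ (e (c w) w).2

lemma two_mul_ncard_edgeSet {V : Type*} [Fintype V] (G : SimpleGraph V) :
    2 * G.edgeSet.ncard = dartsOn G univ := by
  classical
  rw [← coe_edgeFinset, Set.ncard_coe_finset, ← sum_degrees_eq_twice_card_edges, dartsOn]
  refine sum_congr rfl fun v _ ↦ ?_
  rw [← card_neighborFinset_eq_degree, neighborFinset_eq_filter, degOn]

lemma sub_le_two_mul_turanEdges {r : ℕ} (hr : 0 < r) (n : ℕ) :
    (1 - 1 / r) * (n : ℝ) ^ 2 - (r ^ 2 + 2) ≤ 2 * turanEdges r n := by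
  classical
  have hr' : (0 : ℝ) < r := mod_cast hr
  have hcard : turanEdges r n = #(turanGraph n r).edgeFinset := by
    rw [turanEdges, ← coe_edgeFinset, Set.ncard_coe_finset]
  have h1 : (n ^ 2 - (n % r) ^ 2) * (r - 1) < (turanEdges r n + 1) * (2 * r) := by
    rw [hcard, card_edgeFinset_turanGraph, ← Nat.div_lt_iff_lt_mul (by lia)]
    lia
  have hmod : n % r ≤ r := (Nat.mod_lt n hr).le
  have h2 : ((n : ℝ) ^ 2 - r ^ 2) * (r - 1) ≤ (turanEdges r n + 1) * (2 * r) := by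
    have h3 : ((n : ℝ) ^ 2 - ((n % r : ℕ) : ℝ) ^ 2) * (r - 1) < (turanEdges r n + 1) * (2 * r) := by
      have := Nat.pow_le_pow_left (Nat.mod_le n r) 2
      zify [this, (by lia : 1 ≤ r)] at h1
      exact_mod_cast h1
    have h4 : (((n % r : ℕ) : ℝ)) ^ 2 ≤ r ^ 2 := by gcongr
    have h5 : (0 : ℝ) ≤ r - 1 := sub_nonneg.mpr (mod_cast hr)
    nlinarith
  refine le_of_mul_le_mul_right ?_ hr'
  have : ((1 - 1 / r) * (n : ℝ) ^ 2 - (r ^ 2 + 2)) * r = n ^ 2 * (r - 1) - r ^ 3 - 2 * r := by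
    field_simp
    ring
  rw [this]
  nlinarith [sq_nonneg (r : ℝ)]

/-- **Erdős–Simonovits Stability.** For every `η > 0` there are `ξ > 0` and
`n₀` such that for `n > n₀`: every `F`-free `n`-vertex graph with at least `t_r(n) − ξn²`
edges admits a partition of its vertex set into `r` parts with at most `ηn²` edges inside
parts. -/
theorem erdos_simonovits_stability {α : Type} [Fintype α] (r : ℕ) (hr : 2 ≤ r)
    (F : SimpleGraph α) (hF : IsCriticalGraph r F) :
    ∀ η : ℝ, 0 < η → ∃ ξ : ℝ, 0 < ξ ∧ ∃ n₀ : ℕ, ∀ n : ℕ, n₀ < n →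
      ∀ H : SimpleGraph (Fin n),
        (turanEdges r n : ℝ) - ξ * (n : ℝ) ^ 2 ≤ (H.edgeSet.ncard : ℝ) →
        ¬ HasCopy F H →
        ∃ P : Fin n → Fin r,
          (({e ∈ H.edgeSet | ∃ u v : Fin n, e = s(u, v) ∧ P u = P v}).ncard : ℝ) ≤
            η * (n : ℝ) ^ 2 := by
  intro η hη
  classical
  have hcol : F.Colorable (r + 1) := chromaticNumber_le_iff_colorable.mp hF.1.le
  obtain ⟨ξ, hξ, n₁, h⟩ := exists_forall_sum_card_adj_eq_le (t := Fintype.card α + 1) hr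
    (Nat.succ_pos _) (η := 2 * η) (by positivity)
  obtain ⟨n₂, hn₂⟩ := exists_nat_ge ((r ^ 2 + 2) / (ξ / 2) + 1)
  refine ⟨ξ / 4, by positivity, max n₁ n₂, fun n hn H hH hfree ↦ ?_⟩
  have hcard : Fintype.card (Fin n) = n := Fintype.card_fin n
  obtain ⟨P, hP⟩ := h H (by rw [hcard]; exact ((le_max_left _ _).trans_lt hn).le) (by
    rw [hcard, ← two_mul_ncard_edgeSet]
    push_cast
    have h1 := sub_le_two_mul_turanEdges (by lia : 0 < r) n
    have hn₂' : (r ^ 2 + 2) / (ξ / 2) + 1 ≤ (n : ℝ) :=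
      hn₂.trans (mod_cast ((le_max_right _ _).trans_lt hn).le)
    have hn1 : (1 : ℝ) ≤ n := by
      have : 0 ≤ ((r : ℝ) ^ 2 + 2) / (ξ / 2) := by positivity
      linarith
    have h2 : (r : ℝ) ^ 2 + 2 ≤ ξ / 2 * n := by
      rw [← div_le_iff₀' (by positivity)]
      linarith
    have h3 : ξ / 2 * n ≤ ξ / 2 * (n : ℝ) ^ 2 := by
      gcongr
      exact le_self_pow₀ hn1 two_ne_zero
    linarith) fun ⟨A, hA⟩ ↦ hfree (hA.hasCopy hcol (Nat.le_succ _))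
  rw [hcard] at hP
  refine ⟨P, ?_⟩
  let K : SimpleGraph (Fin n) :=
    { Adj := fun u v ↦ H.Adj u v ∧ P u = P v
      symm := ⟨fun _ _ h ↦ ⟨h.1.symm, h.2.symm⟩⟩
      loopless := ⟨fun _ h ↦ h.1.ne rfl⟩ }
  have hK : {e ∈ H.edgeSet | ∃ u v : Fin n, e = s(u, v) ∧ P u = P v} = K.edgeSet := by
    ext e
    induction e with | h x y =>
    simp only [Set.mem_ofPred_eq, mem_edgeSet, K]
    refine and_congr_right fun _ ↦ ⟨?_, fun h ↦ ⟨x, y, rfl, h⟩⟩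
    rintro ⟨u, v, huv, hP⟩
    obtain ⟨rfl, rfl⟩ | ⟨rfl, rfl⟩ := Sym2.eq_iff.mp huv
    · exact hP
    · exact hP.symm
  have hcount : (2 * K.edgeSet.ncard : ℝ) = (∑ v, #{w | H.Adj v w ∧ P v = P w} : ℕ) := by
    rw [← Nat.cast_ofNat, ← Nat.cast_mul, two_mul_ncard_edgeSet, dartsOn]
    congr! 2 with v
    rw [degOn]
    congr!
  rw [hK]
  linarith
end

section
/- (Simonovits) Fix r ≥ 2 and an r-critical graph F. For all sufficiently large n, the Turán number satisfies ex(n, F) = t_r(n); that is, the Turán graph T_r(n) contains no copy of F, and every graph on n vertices with t_r(n) + 1 edges contains at least one copy of F. -/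
open SimpleGraph Finset

/-- Greedy embedding: a partial embedding on `S₀` extends to all of `F` if the target sets `A b`
of the remaining vertices are large and almost completely joined to the relevant `A a`. -/
lemma hasCopy_of_card_nonadj_le {α V : Type*} [Fintype α] {F : SimpleGraph α} {G : SimpleGraph V}
    [DecidableRel G.Adj] {A : α → Finset V} {d : ℕ} {S₀ : Finset α} {f₀ : α → V}
    (hinj : Set.InjOn f₀ S₀) (hmem : ∀ a ∈ S₀, f₀ a ∈ A a)
    (hadj : ∀ a ∈ S₀, ∀ b ∈ S₀, F.Adj a b → G.Adj (f₀ a) (f₀ b))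
    (hd : ∀ a b, F.Adj a b → b ∉ S₀ → ∀ x ∈ A a, #{w ∈ A b | ¬ G.Adj x w} ≤ d)
    (hA : ∀ b ∉ S₀, Fintype.card α * (d + 1) < #(A b)) : HasCopy F G := by
  classical
  have key : ∀ T : Finset α, ∃ f : α → V, Set.InjOn f ↑(S₀ ∪ T) ∧ (∀ a ∈ S₀ ∪ T, f a ∈ A a) ∧
      ∀ a ∈ S₀ ∪ T, ∀ b ∈ S₀ ∪ T, F.Adj a b → G.Adj (f a) (f b) := by
    intro T
    induction T using Finset.induction_on with
    | empty => exact ⟨f₀, by simpa using hinj, by simpa using hmem, by simpa using hadj⟩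
    | insert a T _ ih =>
      obtain ⟨f, h₁, h₂, h₃⟩ := ih
      rw [union_insert]
      generalize hS : S₀ ∪ T = S at *
      by_cases haS : a ∈ S
      · rw [insert_eq_of_mem haS]
        exact ⟨f, h₁, h₂, h₃⟩
      have ha₀ : a ∉ S₀ := fun h ↦ haS (hS ▸ mem_union_left T h)
      let Z := S.biUnion fun s ↦ insert (f s) {w ∈ A a | F.Adj s a ∧ ¬ G.Adj (f s) w}
      have hZ : #Z < #(A a) := by
        refine lt_of_le_of_lt ?_ (hA a ha₀)
        refine (card_biUnion_le_card_mul _ _ (d + 1) fun s hs ↦ ?_).trans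
          (Nat.mul_le_mul_right _ (card_le_univ S))
        refine (card_insert_le _ _).trans (Nat.succ_le_succ ?_)
        by_cases hsa : F.Adj s a
        · simpa [hsa] using hd s a hsa ha₀ (f s) (h₂ s hs)
        · simp [hsa]
      obtain ⟨w, hwA, hwZ⟩ := exists_mem_notMem_of_card_lt_card hZ
      have hw : ∀ s ∈ S, w ≠ f s ∧ (F.Adj s a → G.Adj (f s) w) := by
        intro s hs
        simp only [Z, mem_biUnion, mem_insert, mem_filter, not_exists, not_and, not_or] at hwZ
        refine ⟨(hwZ s hs).1, fun h ↦ ?_⟩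
        by_contra h'
        exact (hwZ s hs).2 hwA h h'
      have hne : ∀ s ∈ S, s ≠ a := fun s hs h ↦ haS (h ▸ hs)
      refine ⟨Function.update f a w, ?_, ?_, ?_⟩
      · intro x hx y hy hxy
        simp only [coe_insert, Set.mem_insert_iff, mem_coe] at hx hy
        rcases hx with rfl | hxS <;> rcases hy with rfl | hyS
        · rfl
        · simp only [Function.update_self, Function.update_of_ne (hne y hyS)] at hxy
          exact absurd hxy (hw y hyS).1
        · simp only [Function.update_self, Function.update_of_ne (hne x hxS)] at hxy
          exact absurd hxy.symm (hw x hxS).1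
        · simp only [Function.update_of_ne (hne x hxS), Function.update_of_ne (hne y hyS)] at hxy
          exact h₁ hxS hyS hxy
      · intro x hx
        rcases mem_insert.1 hx with rfl | hx
        · simpa using hwA
        · simpa [Function.update_of_ne (hne x hx)] using h₂ x hx
      · intro x hx y hy hxy
        rcases mem_insert.1 hx with rfl | hxS <;> rcases mem_insert.1 hy with rfl | hyS
        · exact absurd hxy (F.irrefl)
        · simpa [Function.update_of_ne (hne y hyS)] using ((hw y hyS).2 hxy.symm).symm
        · simpa [Function.update_of_ne (hne x hxS)] using (hw x hxS).2 hxy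
        · simpa [Function.update_of_ne (hne x hxS), Function.update_of_ne (hne y hyS)] using
            h₃ x hxS y hyS hxy
  obtain ⟨f, h₁, -, h₃⟩ := key univ
  rw [union_eq_right.2 (subset_univ _)] at h₁ h₃
  simp only [coe_univ, Set.injOn_univ, mem_univ, forall_const] at h₁ h₃
  exact ⟨⟨f, h₁⟩, h₃⟩

section NearComplete

variable {α V : Type*} [Fintype α] {F : SimpleGraph α} {G : SimpleGraph V} [DecidableRel G.Adj]
  {r d : ℕ} {u v : α} {B : Fin r → Finset V}

lemma hasCopy_of_lt_card_adj (c : α → Fin r)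
    (hc : ∀ a b, F.Adj a b → s(a, b) ≠ s(u, v) → c a ≠ c b)
    (hB : ∀ i j, i ≠ j → ∀ x ∈ B i, #{w ∈ B j | ¬ G.Adj x w} ≤ d)
    (x : V) (hx : ∀ i, Fintype.card α * (d + 1) < #{w ∈ B i | G.Adj x w}) :
    HasCopy F G := by
  classical
  refine hasCopy_of_card_nonadj_le (S₀ := {u}) (f₀ := fun _ ↦ x) (d := d)
    (A := fun a ↦ if a = u then {x} else {w ∈ B (c a) | G.Adj x w}) ?_ ?_ ?_ ?_ ?_
  · simp
  · simp
  · simp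
  · intro a b hab hb y hy
    rw [mem_singleton] at hb
    simp only [hb, if_false]
    by_cases ha : a = u
    · simp only [ha, if_true, mem_singleton] at hy
      subst hy
      rw [filter_filter, filter_false_of_mem (by tauto)]
      simp
    · simp only [ha, if_false, mem_filter] at hy
      refine (card_le_card (filter_subset_filter _ (filter_subset _ _))).trans
        (hB _ _ (hc a b hab ?_) y hy.1)
      simp only [ne_eq, Sym2.eq_iff]
      tauto
  · intro b hb
    rw [mem_singleton] at hb
    simpa only [hb, if_false] using hx (c b)

lemma hasCopy_of_adj (c : α → Fin r)
    (hc : ∀ a b, F.Adj a b → s(a, b) ≠ s(u, v) → c a ≠ c b)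
    (hcuv : c u = c v) (huv : u ≠ v)
    (hB : ∀ i j, i ≠ j → ∀ x ∈ B i, #{w ∈ B j | ¬ G.Adj x w} ≤ d)
    {x y : V} (hxy : G.Adj x y) (hx : ∀ j ≠ c u, #{w ∈ B j | ¬ G.Adj x w} ≤ d)
    (hy : ∀ j ≠ c u, #{w ∈ B j | ¬ G.Adj y w} ≤ d)
    (hcard : ∀ j, Fintype.card α * (d + 1) < #(B j)) : HasCopy F G := by
  classical
  refine hasCopy_of_card_nonadj_le (S₀ := {u, v}) (f₀ := fun a ↦ if a = u then x else y) (d := d)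
    (A := fun a ↦ if a = u then {x} else if a = v then {y} else B (c a)) ?_ ?_ ?_ ?_ ?_
  · intro a ha b hb
    simp only [coe_insert, coe_singleton, Set.mem_insert_iff, Set.mem_singleton_iff] at ha hb
    rcases ha with rfl | rfl <;> rcases hb with rfl | rfl <;>
      simp [huv.symm, hxy.ne, hxy.ne.symm]
  · simp [huv.symm]
  · simp [huv.symm, hxy, hxy.symm]
  · intro a b hab hb z hz
    simp only [mem_insert, mem_singleton, not_or] at hb
    simp only [hb.1, hb.2, if_false]
    have hcab : c a ≠ c b := hc a b hab (by simp only [ne_eq, Sym2.eq_iff]; tauto)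
    by_cases hau : a = u
    · simp only [hau, if_true, mem_singleton] at hz
      subst hz hau
      exact hx _ hcab.symm
    by_cases hav : a = v
    · simp only [hav, huv.symm, if_true, if_false, mem_singleton] at hz
      subst hz hav
      exact hy _ (hcuv ▸ hcab.symm)
    simp only [hau, hav, if_false] at hz
    exact hB _ _ hcab z hz
  · intro b hb
    simp only [mem_insert, mem_singleton, not_or] at hb
    simpa only [hb.1, hb.2, if_false] using hcard (c b)

end NearComplete

section Structure

variable {α V : Type*} [Fintype α] [Fintype V] {F : SimpleGraph α} {G : SimpleGraph V}
  [DecidableRel G.Adj] {r : ℕ} {u v : α}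

/-- A copy-free graph with few non-adjacencies at each vertex, and with `r` disjoint independent
sets covering nearly all vertices, is `r`-colorable. -/
lemma colorable_of_independent_cover (hr : 0 < r) (huv : u ≠ v)
    (hcrit : ∀ i : Fin r, ∃ c : α → Fin r, c u = i ∧ c v = i ∧
      ∀ a b, F.Adj a b → s(a, b) ≠ s(u, v) → c a ≠ c b)
    (hG : ¬ HasCopy F G) (hdeg : ∀ x, r * #{w | ¬ G.Adj x w} ≤ Fintype.card V + r)
    {U : Fin r → Finset V} (hdisj : ∀ i j, i ≠ j → Disjoint (U i) (U j))
    (hind : ∀ i, ∀ x ∈ U i, ∀ y ∈ U i, ¬ G.Adj x y) {b : ℕ}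
    (hcover : Fintype.card V ≤ ∑ i, #(U i) + b)
    (hlarge : r * (Fintype.card α + 1) ^ 2 * (b + r + 1) < Fintype.card V) :
    G.Colorable r := by
  classical
  set n := Fintype.card V with hn
  set m := Fintype.card α with hm
  set D := (n + r) / r with hD
  have hdegD : ∀ x, #{w | ¬ G.Adj x w} ≤ D := fun x ↦
    (Nat.le_div_iff_mul_le hr).2 (by rw [mul_comm]; exact hdeg x)
  have hrD : r * D ≤ n + r := Nat.mul_div_le _ _
  have hUD : ∀ i, #(U i) ≤ D := by
    intro i
    rcases (U i).eq_empty_or_nonempty with h | ⟨x, hx⟩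
    · simp [h]
    · exact (card_le_card fun y hy ↦ by simpa using hind i x hx y hy).trans (hdegD x)
  have hUlow : ∀ i, n + r ≤ r * #(U i) + r * b + r * r := by
    intro i
    have h₁ : ∑ j ∈ univ.erase i, #(U j) ≤ (r - 1) * D := by
      refine (sum_le_card_nsmul _ _ D fun j _ ↦ hUD j).trans ?_
      simp
    rw [← add_sum_erase _ _ (mem_univ i)] at hcover
    obtain ⟨k, rfl⟩ : ∃ k, r = k + 1 := ⟨r - 1, by lia⟩
    simp only [add_tsub_cancel_right] at h₁
    nlinarith
  have hDU : ∀ i, D ≤ #(U i) + (b + r) := by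
    intro i
    have := hUlow i
    refine le_of_mul_le_mul_left (a := r) ?_ hr
    linarith
  have hmiss : ∀ i j, i ≠ j → ∀ x, ∀ s, #{w ∈ U i | G.Adj x w} ≤ s →
      #{w ∈ U j | ¬ G.Adj x w} ≤ b + r + s := by
    intro i j hij x s hs
    have h₁ := card_filter_add_card_filter_not (s := U i) (G.Adj x)
    have h₂ : #{w ∈ U i | ¬ G.Adj x w} + #{w ∈ U j | ¬ G.Adj x w} ≤ D := by
      rw [← card_union_of_disjoint (disjoint_filter_filter (hdisj i j hij))]
      refine (card_le_card fun w hw ↦ ?_).trans (hdegD x)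
      simp only [mem_union, mem_filter, mem_univ, true_and] at hw ⊢
      tauto
    have := hDU i
    lia
  have hUU : ∀ i j, i ≠ j → ∀ x ∈ U i, #{w ∈ U j | ¬ G.Adj x w} ≤ b + r := by
    intro i j hij x hx
    simpa using hmiss i j hij x 0 (by simpa [filter_eq_empty_iff] using fun w ↦ hind i x hx w)
  have hfew : ∀ x, ∃ i, #{w ∈ U i | G.Adj x w} ≤ m * (b + r + 1) := by
    intro x
    by_contra! h
    obtain ⟨c, -, -, hc⟩ := hcrit ⟨0, hr⟩
    exact hG (hasCopy_of_lt_card_adj c hc hUU x h)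
  choose col hcol using hfew
  have hbig : ∀ j, m * (b + r + m * (b + r + 1) + 1) < #(U j) := by
    intro j
    have := hUlow j
    refine Nat.lt_of_mul_lt_mul_left (a := r) ?_
    nlinarith [Nat.zero_le (r * m * (b + r + 1)), Nat.zero_le (r * b), Nat.zero_le (r * r)]
  refine ⟨Coloring.mk col fun {x y} hxy heq ↦ hG ?_⟩
  obtain ⟨c, hcu, hcv, hc⟩ := hcrit (col x)
  exact hasCopy_of_adj c hc (hcu.trans hcv.symm) huv
    (fun i j hij x hx ↦ (hUU i j hij x hx).trans (Nat.le_add_right _ (m * (b + r + 1)))) hxy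
    (fun j hj ↦ hmiss _ j (hcu ▸ hj.symm) x _ (hcol x))
    (fun j hj ↦ hmiss _ j (heq ▸ hcu ▸ hj.symm) y _ (hcol y)) hbig

/-- A copy-free graph with few non-adjacencies at each vertex that contains a large balanced
complete `r`-partite graph is `r`-colorable. -/
lemma colorable_of_complete_equipartite (hr : 0 < r) (huv : u ≠ v)
    (hcrit : ∀ i : Fin r, ∃ c : α → Fin r, c u = i ∧ c v = i ∧
      ∀ a b, F.Adj a b → s(a, b) ≠ s(u, v) → c a ≠ c b)
    (hG : ¬ HasCopy F G) (hdeg : ∀ x, r * #{w | ¬ G.Adj x w} ≤ Fintype.card V + r)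
    {B : Fin r → Finset V} {T d : ℕ} (hT : ∀ i, #(B i) = T)
    (hB : ∀ i j, i ≠ j → ∀ x ∈ B i, ∀ y ∈ B j, G.Adj x y)
    (hd : d = 2 * r * (Fintype.card α + 1) ^ 3) (hTd : Fintype.card α * (d + 1) < T)
    (hlarge : r * T ≤ Fintype.card V)
    (hlarge' : 2 * r * (Fintype.card α + 1) ^ 2 * (r + 1) < Fintype.card V) :
    G.Colorable r := by
  classical
  set n := Fintype.card V with hn
  set m := Fintype.card α with hm
  have hBB : ∀ i j, i ≠ j → ∀ x ∈ B i, #{w ∈ B j | ¬ G.Adj x w} ≤ 0 := by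
    intro i j hij x hx
    simpa [filter_eq_empty_iff] using fun w ↦ hB i j hij x hx w
  have hfew : ∀ x, ∃ i, #{w ∈ B i | G.Adj x w} ≤ m := by
    intro x
    by_contra! h
    obtain ⟨c, -, -, hc⟩ := hcrit ⟨0, hr⟩
    exact hG (hasCopy_of_lt_card_adj c hc hBB x (by simpa using h))
  choose col hcol using hfew
  let Z : Finset V := {x | ∃ j ≠ col x, d < #{w ∈ B j | ¬ G.Adj x w}}
  let U : Fin r → Finset V := fun i ↦ {x | col x = i ∧ x ∉ Z}
  have hcard : n = ∑ i, #(U i) + #Z := by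
    have h₁ := card_eq_sum_card_fiberwise (s := Zᶜ) (t := univ) (f := col) (by simp [Set.MapsTo])
    have h₂ : ∀ i, #{x ∈ Zᶜ | col x = i} = #(U i) := by
      intro i
      congr 1
      ext x
      simp [U, and_comm]
    simp only [h₂] at h₁
    rw [← h₁, card_compl_add_card]
  have hdouble : ∑ x, ∑ j, #{w ∈ B j | ¬ G.Adj x w} =
      ∑ j, ∑ w ∈ B j, #{x | ¬ G.Adj w x} := by
    rw [sum_comm]
    refine sum_congr rfl fun j _ ↦ ?_
    simp only [card_filter]
    rw [sum_comm]
    simp only [G.adj_comm]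
  have hupper : r * ∑ x, ∑ j, #{w ∈ B j | ¬ G.Adj x w} ≤ r * (T * (n + r)) := by
    rw [hdouble, mul_sum]
    refine (sum_le_card_nsmul _ _ (T * (n + r)) fun j _ ↦ ?_).trans (by simp)
    rw [mul_sum, ← hT j]
    exact sum_le_card_nsmul _ _ _ fun w _ ↦ hdeg w
  have hlower : n * T + d * #Z ≤ ∑ x, (∑ j, #{w ∈ B j | ¬ G.Adj x w} + m) := by
    have h₁ : n * T + d * #Z = ∑ x, (T + if x ∈ Z then d else 0) := by
      simp [sum_add_distrib, mul_comm, hn]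
    rw [h₁]
    refine sum_le_sum fun x _ ↦ ?_
    have h₂ := card_filter_add_card_filter_not (s := B (col x)) (G.Adj x)
    rw [hT] at h₂
    have h₃ := hcol x
    rw [← add_sum_erase _ _ (mem_univ (col x))]
    split_ifs with hx
    · obtain ⟨j, hj, hdj⟩ := (mem_filter.1 hx).2
      have h₄ := single_le_sum (f := fun j ↦ #{w ∈ B j | ¬ G.Adj x w})
        (fun _ _ ↦ Nat.zero_le _) (mem_erase.2 ⟨hj, mem_univ j⟩)
      lia
    · lia
  have hZ : d * #Z ≤ (m + 1) * n := by
    have h₁ := Nat.le_of_mul_le_mul_left hupper hr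
    simp only [sum_add_distrib, sum_const, smul_eq_mul, card_univ] at hlower
    nlinarith
  have hZ' : 2 * r * (m + 1) ^ 2 * #Z ≤ n := by
    refine le_of_mul_le_mul_left (a := m + 1) ?_ (Nat.succ_pos _)
    rw [hd] at hZ
    linarith
  refine colorable_of_independent_cover hr huv hcrit hG hdeg (U := U) (b := #Z) ?_ ?_ hcard.le ?_
  · intro i j hij
    rw [Finset.disjoint_left]
    intro x hx hx'
    exact hij ((mem_filter.1 hx).2.1.symm.trans (mem_filter.1 hx').2.1)
  · intro i x hx y hy hxy
    have hsmall : ∀ z ∈ U i, ∀ j ≠ i, #{w ∈ B j | ¬ G.Adj z w} ≤ d := by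
      intro z hz j hj
      simp only [U, Z, mem_filter, mem_univ, true_and, not_exists, not_and, not_lt] at hz
      exact hz.2 j (hz.1 ▸ hj)
    obtain ⟨c, hcu, hcv, hc⟩ := hcrit i
    exact hG (hasCopy_of_adj c hc (hcu.trans hcv.symm) huv
      (fun i j hij x hx ↦ (hBB i j hij x hx).trans (Nat.zero_le d)) hxy
      (hcu ▸ hsmall x hx) (hcu ▸ hsmall y hy) (fun j ↦ (hT j).symm ▸ hTd))
  · linarith

end Structure

/-- Minimum degree version of Simonovits' theorem: large copy-free graphs whose minimum degree is
at least that of the Turán graph are `r`-colorable. -/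
lemma exists_forall_colorable_of_degree {α : Type*} [Fintype α] {F : SimpleGraph α} {r : ℕ}
    (hr : 2 ≤ r) {u v : α} (huv : u ≠ v)
    (hcrit : ∀ i : Fin r, ∃ c : α → Fin r, c u = i ∧ c v = i ∧
      ∀ a b, F.Adj a b → s(a, b) ≠ s(u, v) → c a ≠ c b) :
    ∃ N : ℕ, ∀ n, N ≤ n → ∀ (G : SimpleGraph (Fin n)) [DecidableRel G.Adj], ¬ HasCopy F G →
      (∀ x, r * n ≤ r * G.degree x + n + r) → G.Colorable r := by
  classical
  obtain ⟨k, rfl⟩ : ∃ k, r = k + 1 := ⟨r - 1, by lia⟩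
  have hk : (0 : ℝ) < k := by exact_mod_cast (by lia : 0 < k)
  set m := Fintype.card α with hm
  set d := 2 * (k + 1) * (m + 1) ^ 3 with hd
  set T := m * (d + 1) + 1 with hT
  have hε : (0 : ℝ) < 1 / (2 * k * (k + 1)) := by positivity
  obtain ⟨N, hN⟩ := Filter.eventually_atTop.1
    (eventually_completeEquipartiteGraph_isContained_of_minDegree hε k T)
  refine ⟨max N (max (2 * k * (k + 1)) (max ((k + 1) * T)
    (2 * (k + 1) * (m + 1) ^ 2 * (k + 1 + 1) + 1))), fun n hn G _ hG hdeg ↦ ?_⟩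
  simp only [max_le_iff] at hn
  obtain ⟨hn₁, hn₂, hn₃, hn₄⟩ := hn
  have : Nonempty (Fin n) := ⟨⟨0, by lia⟩⟩
  have hmin : (G.minDegree : ℝ) ≥ (1 - 1 / k + 1 / (2 * k * (k + 1))) * n := by
    obtain ⟨x, hx⟩ := G.exists_minimal_degree_vertex
    rw [hx]
    have h₁ : ((k + 1 : ℝ)) * n ≤ (k + 1) * G.degree x + n + (k + 1) := by exact_mod_cast hdeg x
    have h₂ : 2 * k * (k + 1) ≤ (n : ℝ) := by exact_mod_cast hn₂
    have h₃ : (1 - 1 / k + 1 / (2 * k * (k + 1))) * (n : ℝ) =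
        (2 * k * (k * n - (k + 1)) + (2 * k * (k + 1) - n)) / (2 * k * (k + 1)) := by
      field_simp
      ring
    rw [h₃, ge_iff_le, div_le_iff₀ (by positivity)]
    nlinarith
  obtain ⟨f⟩ := hN n hn₁ hmin
  refine colorable_of_complete_equipartite (T := T) (d := d)
    (B := fun i ↦ univ.image fun j : Fin T ↦ f (i, j)) (by lia) huv hcrit hG ?_ ?_ ?_ hd
    (by lia) (by simpa using hn₃) (by simpa using hn₄)
  · intro x
    have h₁ := card_filter_add_card_filter_not (s := univ) (G.Adj x)
    rw [← neighborFinset_eq_filter, card_neighborFinset_eq_degree, card_univ, Fintype.card_fin]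
      at h₁
    have := hdeg x
    rw [Fintype.card_fin]
    nlinarith
  · intro i
    rw [card_image_of_injective _ fun a b hab ↦ by simpa using f.injective hab]
    simp
  · intro i j hij x hx y hy
    simp only [mem_image, mem_univ, true_and] at hx hy
    obtain ⟨a, rfl⟩ := hx
    obtain ⟨b, rfl⟩ := hy
    exact f.toHom.map_adj (by simpa using hij)

lemma card_edgeFinset_turanGraph_succ_ge {r : ℕ} (hr : 0 < r) (k : ℕ) :
    #(turanGraph k r).edgeFinset + (k - k / r) ≤ #(turanGraph (k + 1) r).edgeFinset := by
  have hcount : ∑ w ∈ range k, (if k % r ≠ w % r then 1 else 0) = k - k / r := by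
    have h₁ := card_filter_add_card_filter_not (s := range k) (fun w ↦ k % r ≠ w % r)
    have h₂ : #{w ∈ range k | ¬ k % r ≠ w % r} = k / r := by
      have := Nat.count_modEq_card k hr k
      rw [Nat.count_eq_card_filter_range] at this
      simpa [Nat.ModEq, eq_comm] using this
    rw [← card_filter]
    rw [card_range] at h₁
    lia
  have htwice : ∀ n, 2 * #(turanGraph n r).edgeFinset =
      ∑ v ∈ range n, ∑ w ∈ range n, if v % r ≠ w % r then 1 else 0 := by
    intro n
    rw [← sum_degrees_eq_twice_card_edges, ← Fin.sum_univ_eq_sum_range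
      (fun v ↦ ∑ w ∈ range n, if v % r ≠ w % r then 1 else 0)]
    refine sum_congr rfl fun v _ ↦ ?_
    rw [← Fin.sum_univ_eq_sum_range (fun w ↦ if v % r ≠ w % r then 1 else 0),
      ← card_neighborFinset_eq_degree, neighborFinset_eq_filter, card_filter]
    rfl
  have h₁ := htwice k
  have h₂ := htwice (k + 1)
  simp only [sum_range_succ, sum_add_distrib, hcount] at h₂
  have hcount' : ∑ v ∈ range k, (if v % r ≠ k % r then 1 else 0) = k - k / r := by
    simpa only [ne_comm] using hcount
  rw [hcount'] at h₂
  lia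

lemma HasCopy.of_isContained {α β γ : Type*} {F : SimpleGraph α} {G : SimpleGraph β}
    {H : SimpleGraph γ} (h : HasCopy F G) (hGH : G ⊑ H) : HasCopy F H := by
  obtain ⟨f, hf⟩ := h
  obtain ⟨g⟩ := hGH
  exact ⟨f.trans g.toEmbedding, fun _ _ hab ↦ g.toHom.map_adj (hf hab)⟩

lemma card_edgeFinset_le_turanGraph_of_colorable {n r : ℕ} (hr : 0 < r) {G : SimpleGraph (Fin n)}
    [DecidableRel G.Adj] (hG : G.Colorable r) :
    #G.edgeFinset ≤ #(turanGraph n r).edgeFinset :=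
  (isTuranMaximal_turanGraph hr).2 (hG.cliqueFree (Nat.lt_succ_self r))

/-- If every graph on at least `N` vertices with minimum degree at least that of the Turán graph
and more edges than the Turán graph contains `F`, then so does every graph on sufficiently many
vertices with more edges than the Turán graph. -/
lemma hasCopy_of_turan_lt {α : Type*} {F : SimpleGraph α} {r N : ℕ} (hr : 0 < r)
    (hN : ∀ n, N ≤ n → ∀ (G : SimpleGraph (Fin n)) [DecidableRel G.Adj],
      (∀ x, r * n ≤ r * G.degree x + n + r) →
      #(turanGraph n r).edgeFinset < #G.edgeFinset → HasCopy F G) (n : ℕ) :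
    ∀ (G : SimpleGraph (Fin n)) [DecidableRel G.Adj],
      #(turanGraph n r).edgeFinset < #G.edgeFinset →
      #(turanGraph n r).edgeFinset + N ^ 2 + N < #G.edgeFinset + n → HasCopy F G := by
  classical
  induction n with
  | zero =>
    intro G _ _ h
    have : #G.edgeFinset ≤ (Fintype.card (Fin 0)).choose 2 := card_edgeFinset_le_card_choose_two
    rw [Fintype.card_fin, Nat.choose_zero_succ] at this
    lia
  | succ k ih =>
    intro G _ h h'
    by_cases hkN : N ≤ k + 1
    swap
    · have h₁ : #G.edgeFinset ≤ (Fintype.card (Fin (k + 1))).choose 2 :=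
        card_edgeFinset_le_card_choose_two
      rw [Fintype.card_fin] at h₁
      have h₂ := Nat.choose_le_pow (k + 1) 2
      have h₃ : (k + 1) ^ 2 ≤ N ^ 2 := Nat.pow_le_pow_left (by lia) 2
      lia
    by_cases hdeg : ∀ x, r * (k + 1) ≤ r * G.degree x + (k + 1) + r
    · exact hN _ hkN G hdeg h
    push Not at hdeg
    obtain ⟨x, hx⟩ := hdeg
    have hdx : G.degree x < k - k / r := by
      by_contra! hle
      have h₁ : r * (k / r) ≤ k := Nat.mul_div_le k r
      have h₂ : k ≤ G.degree x + k / r := by lia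
      nlinarith
    have hT := card_edgeFinset_turanGraph_succ_ge hr k
    let G' := G.induce ({x}ᶜ : Set (Fin (k + 1)))
    have hG' : #G'.edgeFinset = #G.edgeFinset - G.degree x := by
      rw [← card_edgeFinset_deleteIncidenceSet, ← card_edgeFinset_induce_compl_singleton]
    have hcard : Fintype.card ({x}ᶜ : Set (Fin (k + 1))) = k := by
      rw [Fintype.card_compl_set]
      simp
    let e := Fintype.equivFinOfCardEq hcard
    let i : G' ≃g G'.map e.toEmbedding := Iso.map e G'
    have hi : #(G'.map e.toEmbedding).edgeFinset = #G'.edgeFinset := i.card_edgeFinset_eq.symm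
    have := ih (G'.map e.toEmbedding) (by lia) (by lia)
    exact this.of_isContained ⟨(Embedding.induce _).toCopy.comp i.symm.toCopy⟩

lemma IsCriticalGraph.exists_coloring {α : Type*} {F : SimpleGraph α} {r : ℕ}
    (hF : IsCriticalGraph r F) : ∃ u v : α, u ≠ v ∧ ∀ i : Fin r, ∃ c : α → Fin r, c u = i ∧
      c v = i ∧ ∀ a b, F.Adj a b → s(a, b) ≠ s(u, v) → c a ≠ c b := by
  obtain ⟨hχ, e, he, hχe⟩ := hF
  induction e with | _ u v
  obtain ⟨C⟩ : (F.deleteEdges {s(u, v)}).Colorable r := chromaticNumber_le_iff_colorable.1 hχe.le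
  have hC : ∀ a b, F.Adj a b → s(a, b) ≠ s(u, v) → C a ≠ C b := fun a b hab hne ↦
    C.valid (deleteEdges_adj.2 ⟨hab, hne⟩)
  have huv : C u = C v := by
    by_contra hne
    have hcol : F.Colorable r := ⟨Coloring.mk C fun {a b} hab ↦ by
      by_cases h : s(a, b) = s(u, v)
      · rcases Sym2.eq_iff.1 h with ⟨rfl, rfl⟩ | ⟨rfl, rfl⟩
        · exact hne
        · exact Ne.symm hne
      · exact hC a b hab h⟩
    have h := chromaticNumber_le_iff_colorable.2 hcol
    rw [hχ, Nat.cast_le] at h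
    lia
  refine ⟨u, v, Adj.ne he, fun i ↦ ⟨fun a ↦ Equiv.swap (C u) i (C a), by simp,
    by simp [← huv], fun a b hab hne h ↦ hC a b hab hne ((Equiv.swap (C u) i).injective h)⟩⟩

/-- **Simonovits.** For `r ≥ 2` and `r`-critical `F`, for all large `n`:
`ex(n, F) = t_r(n)`, i.e. `T_r(n)` contains no copy of `F` and every `n`-vertex graph with
`t_r(n) + 1` edges contains a copy of `F`. -/
theorem simonovits_critical_turan {α : Type} [Fintype α] (r : ℕ) (hr : 2 ≤ r)
    (F : SimpleGraph α) (hF : IsCriticalGraph r F) :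
    ∃ n₀ : ℕ, ∀ n : ℕ, n₀ < n →
      ¬ HasCopy F (SimpleGraph.turanGraph n r) ∧
      ∀ H : SimpleGraph (Fin n), H.edgeSet.ncard = turanEdges r n + 1 → HasCopy F H := by
  classical
  have hr₀ : 0 < r := by lia
  obtain ⟨u, v, huv, hcrit⟩ := hF.exists_coloring
  obtain ⟨N, hN⟩ := exists_forall_colorable_of_degree hr huv hcrit
  refine ⟨N ^ 2 + N, fun n hn ↦ ⟨?_, fun H hH ↦ ?_⟩⟩
  · rintro ⟨f, hf⟩
    have hcol : F.Colorable r := ⟨Coloring.mk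
      (fun a ↦ (⟨(f a : ℕ) % r, Nat.mod_lt _ hr₀⟩ : Fin r)) fun {a b} hab ↦ by
        simpa using turanGraph_adj.1 (hf hab)⟩
    have h := chromaticNumber_le_iff_colorable.2 hcol
    rw [hF.1, Nat.cast_le] at h
    lia
  · rw [turanEdges, ← coe_edgeFinset, ← coe_edgeFinset, Set.ncard_coe_finset,
      Set.ncard_coe_finset] at hH
    refine hasCopy_of_turan_lt (N := N) hr₀ (fun n hn G _ hdeg hlt ↦ ?_) n H (by lia) (by lia)
    by_contra hG
    exact hlt.not_ge (card_edgeFinset_le_turanGraph_of_colorable hr₀ (hN n hn G hG hdeg))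
end

section
/- Fix r ≥ 2 and an r-critical graph F. The function n ↦ c(n,F) is nondecreasing: for all positive integers n ≤ n', c(n,F) ≤ c(n',F). -/
open SimpleGraph Finset

theorem copyCount_le_copyCount {α β γ : Type*} [Finite α] [Finite γ] (F : SimpleGraph α)
    {G : SimpleGraph β} {H : SimpleGraph γ} (f : β ↪ γ)
    (hf : ∀ ⦃a b⦄, G.Adj a b → H.Adj (f a) (f b)) : copyCount F G ≤ copyCount F H := by
  have : Finite (α ↪ γ) := DFunLike.finite _
  refine Nat.div_le_div_right (Nat.card_le_card_of_injective
    (fun g => ⟨g.1.trans f, fun u v h => hf (g.2 h)⟩) fun g g' h => ?_)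
  ext x
  exact f.injective (DFunLike.congr_fun (congrArg Subtype.val h) x)

/-- An injection separating residue classes bounds `c(n,F)` by the number of copies of `F` in a
larger Turán graph with an extra edge in the image. -/
theorem critCount_le_copyCount {α : Type*} [Finite α] (F : SimpleGraph α) {r n m : ℕ}
    (f : Fin n ↪ Fin m)
    (hf : ∀ a b : Fin n, (a : ℕ) % r ≠ (b : ℕ) % r → (f a : ℕ) % r ≠ (f b : ℕ) % r)
    {a b : Fin n} (hab : a ≠ b) (hr : (a : ℕ) % r = (b : ℕ) % r) :
    critCount r n F ≤
      copyCount F (SimpleGraph.turanGraph m r ⊔ SimpleGraph.fromEdgeSet {s(f a, f b)}) := by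
  refine le_trans (Nat.sInf_le ⟨a, b, hab, hr, rfl⟩) (copyCount_le_copyCount F f fun x y h => ?_)
  rw [SimpleGraph.sup_adj, SimpleGraph.fromEdgeSet_adj, Set.mem_singleton_iff] at h ⊢
  rcases h with h | ⟨h, hne⟩
  · exact Or.inl (hf x y h)
  · refine Or.inr ⟨?_, f.injective.ne hne⟩
    simpa using congrArg (Sym2.map f) h

theorem critCount_le_copyCount_last {α : Type*} [Finite α] (F : SimpleGraph α) {r n : ℕ}
    (hr : 0 < r) (hrn : r < n) (v : Fin n) (hv : n % r = (v : ℕ) % r) :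
    critCount r n F ≤ copyCount F (SimpleGraph.turanGraph (n + 1) r ⊔
      SimpleGraph.fromEdgeSet {s(Fin.last n, v.castSucc)}) := by
  by_cases hn : 2 * r ≤ n
  · obtain ⟨w, hwv, hw⟩ : ∃ w : Fin n, w ≠ v ∧ (w : ℕ) % r = n % r := by
      by_cases h : (v : ℕ) = n - r
      · refine ⟨⟨n - 2 * r, by omega⟩, fun hh => ?_, ?_⟩
        · have := congrArg Fin.val hh
          simp only at this
          omega
        · conv_rhs => rw [← Nat.sub_add_cancel hn, Nat.add_mul_mod_self_right]
      · refine ⟨⟨n - r, by omega⟩, fun hh => h (congrArg Fin.val hh).symm, ?_⟩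
        conv_rhs => rw [← Nat.sub_add_cancel hrn.le, Nat.add_mod_right]
    obtain ⟨f, hfx⟩ : ∃ f : Fin n ↪ Fin (n + 1),
        ∀ x, f x = if x = w then Fin.last n else x.castSucc :=
      ⟨⟨fun x => if x = w then Fin.last n else x.castSucc, fun x y h => by
        simp only [Fin.ext_iff] at h ⊢
        split_ifs at h <;> simp at h <;> omega⟩, fun _ => rfl⟩
    have hf : ∀ x : Fin n, (f x : ℕ) % r = (x : ℕ) % r := fun x => by
      by_cases hx : x = w <;> simp [hfx, hx, hw]
    have := critCount_le_copyCount F f (fun a b h => by rwa [hf, hf]) hwv (hw.trans hv)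
    simpa [hfx, hwv.symm] using this
  · have hn' : n % r = n - r := by
      rw [Nat.mod_eq_sub_mod hrn.le, Nat.mod_eq_of_lt (by omega)]
    have key : ∀ x : ℕ, x < 2 * r → x % r = if x < r then x else x - r := fun x hx => by
      split_ifs with h
      · exact Nat.mod_eq_of_lt h
      · rw [Nat.mod_eq_sub_mod (by omega), Nat.mod_eq_of_lt (by omega)]
    have hvn : (v : ℕ) = n - r := by
      have h₁ := v.isLt
      rw [hn', key v (by omega)] at hv
      split_ifs at hv <;> omega
    obtain ⟨f, hfx⟩ : ∃ f : Fin n ↪ Fin (n + 1), ∀ x, (f x : ℕ) =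
        if (x : ℕ) = 0 then n - r else if (x : ℕ) = r then n
          else if (x : ℕ) = n - r then 0 else x :=
      ⟨⟨fun x => ⟨if (x : ℕ) = 0 then n - r else if (x : ℕ) = r then n
          else if (x : ℕ) = n - r then 0 else x, by split_ifs <;> omega⟩, fun x y h => by
        simp only [Fin.ext_iff] at h ⊢
        split_ifs at h <;> omega⟩, fun _ => rfl⟩
    have := critCount_le_copyCount F (r := r) f (fun a b h => by
      have ha := (f a).isLt
      have hb := (f b).isLt
      rw [key _ (by omega), key _ (by omega)] at h ⊢
      rw [hfx, hfx]
      split_ifs at h ⊢ <;> omega) (a := ⟨r, hrn⟩) (b := ⟨0, by omega⟩) (by simp; omega) (by simp)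
    convert this using 5
    congr 1
    · ext; simp [hfx]; omega
    · ext; simp [hfx, hvn]

theorem critCount_le_critCount_succ {α : Type*} [Finite α] (r n : ℕ) (hr : 0 < r)
    (F : SimpleGraph α) : critCount r n F ≤ critCount r (n + 1) F := by
  by_cases hn : n ≤ r
  · refine (Nat.sInf_eq_zero.2 (Or.inr ?_)).trans_le (Nat.zero_le _)
    refine Set.eq_empty_iff_forall_notMem.2 ?_
    rintro m ⟨u, v, huv, h, -⟩
    rw [Nat.mod_eq_of_lt (by omega), Nat.mod_eq_of_lt (by omega)] at h
    exact huv (Fin.ext h)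
  push Not at hn
  refine le_csInf ⟨_, ⟨0, by omega⟩, ⟨r, by omega⟩, by simp; omega, by simp, rfl⟩ ?_
  rintro m ⟨u, v, huv, h, rfl⟩
  cases u using Fin.lastCases with
  | last =>
    cases v using Fin.lastCases with
    | last => exact absurd rfl huv
    | cast v => exact critCount_le_copyCount_last F hr hn v (by simpa using h)
  | cast u =>
    cases v using Fin.lastCases with
    | last =>
      rw [Sym2.eq_swap]
      exact critCount_le_copyCount_last F hr hn u (by simpa using h.symm)
    | cast v =>
      exact critCount_le_copyCount F Fin.castSuccEmb (fun a b h => h)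
        (fun hh => huv (congrArg _ hh)) h

/-- For `r ≥ 2` and `r`-critical `F`, `n ↦ c(n,F)` is nondecreasing on
the positive integers. -/
theorem critCount_monotone {α : Type} [Fintype α] (r : ℕ) (hr : 2 ≤ r)
    (F : SimpleGraph α) (hF : IsCriticalGraph r F) :
    ∀ n n' : ℕ, 0 < n → n ≤ n' → critCount r n F ≤ critCount r n' F := by
  intro n n' _ hn
  exact monotone_nat_of_le_succ (f := fun n => critCount r n F)
    (fun n => critCount_le_critCount_succ r n (by omega) F) hn
end
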